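/- arXiv:1102.3978 — 7 statements merged into one kernel-verified Lean document; each statement's English description precedes it below -/
import Mathlib

section
/- For every integer m ≥ 1 and every integer n ≥ 0, the number of m-ary trees with exactly n nodes equals binom(mn, n) / ((m−1)n + 1). -/
/-- An `m`-ary tree: a finite set of words over the alphabet `Fin m` (i.e. `{1,…,m}`)
closed under taking prefixes (left subwords); its nodes are its elements. -/
def IsTree {m : ℕ} (T : Finset (List (Fin m))) : Prop :=
  ∀ w ∈ T, ∀ p : List (Fin m), p <+: w → p ∈ T

/-- The set of trees with `n` nodes. -/
def treeSet (m n : ℕ) : Set (Finset (List (Fin m))) := {T | IsTree T ∧ T.card = n}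

lemma treeSet_finite (m n : ℕ) : (treeSet m n).Finite := by
  have hfin : {l : List (Fin m) | l.length ≤ n}.Finite := List.finite_length_le (Fin m) n
  refine (hfin.toFinset.powerset.finite_toSet).subset ?_
  rintro T ⟨hT, hc⟩
  simp only [Finset.coe_powerset, Set.mem_preimage, Set.mem_powerset_iff, Finset.coe_subset]
  intro w hw
  simp only [Set.Finite.mem_toFinset, Set.mem_ofPred_eq]
  have h : (Finset.range (w.length + 1)).card ≤ T.card := by
    refine Finset.card_le_card_of_injOn (fun i => w.take i) ?_ ?_
    · intro i _
      exact hT w hw _ (List.take_prefix i w)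
    · intro i hi j hj hij
      have := congrArg List.length hij
      simp at this hi hj
      omega
  simp at h
  omega

noncomputable def trees (m n : ℕ) : Finset (Finset (List (Fin m))) := (treeSet_finite m n).toFinset

lemma mem_trees {m n : ℕ} {T : Finset (List (Fin m))} :
    T ∈ trees m n ↔ IsTree T ∧ T.card = n := by
  simp [trees, treeSet]

/-- Graft `m` trees onto a root. -/
def graft {m : ℕ} (f : Fin m → Finset (List (Fin m))) : Finset (List (Fin m)) :=
  insert [] ((Finset.univ.sigma f).image (fun x => x.1 :: x.2))

lemma nil_mem_graft {m : ℕ} (f : Fin m → Finset (List (Fin m))) : [] ∈ graft f := by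
  simp [graft]

lemma cons_mem_graft {m : ℕ} (f : Fin m → Finset (List (Fin m))) (i : Fin m) (w) :
    i :: w ∈ graft f ↔ w ∈ f i := by
  simp [graft]

lemma graft_injective {m : ℕ} : Function.Injective (graft (m := m)) := by
  intro f g h
  funext i
  ext w
  rw [← cons_mem_graft, h, cons_mem_graft]

lemma card_graft {m : ℕ} (f : Fin m → Finset (List (Fin m))) :
    (graft f).card = ∑ i, (f i).card + 1 := by
  unfold graft
  rw [Finset.card_insert_of_notMem (by simp), Finset.card_image_of_injective, Finset.card_sigma]
  rintro ⟨i, w⟩ ⟨j, v⟩ h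
  simp at h
  obtain ⟨rfl, rfl⟩ := h
  rfl

lemma isTree_graft {m : ℕ} (f : Fin m → Finset (List (Fin m))) :
    IsTree (graft f) ↔ ∀ i, IsTree (f i) := by
  constructor
  · intro h i w hw p hp
    rw [← cons_mem_graft] at hw ⊢
    exact h _ hw _ (by simpa using hp)
  · intro h w hw p hp
    cases p with
    | nil => exact nil_mem_graft f
    | cons i p =>
      obtain ⟨t, rfl⟩ := hp
      rw [List.cons_append, cons_mem_graft] at hw
      rw [cons_mem_graft]
      exact h i _ hw _ (List.prefix_append p t)

lemma exists_graft {m : ℕ} (T : Finset (List (Fin m))) (h : [] ∈ T) : ∃ f, graft f = T := by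
  classical
  refine ⟨fun i => T.preimage (fun w => i :: w) (List.cons_injective.injOn), ?_⟩
  ext w
  cases w with
  | nil => simp [h, nil_mem_graft]
  | cons i w => rw [cons_mem_graft, Finset.mem_preimage]

lemma trees_zero (m : ℕ) : (trees m 0).card = 1 := by
  have : trees m 0 = {∅} := by
    ext T
    rw [mem_trees]
    simp only [Finset.card_eq_zero, Finset.mem_singleton]
    constructor
    · exact fun h => h.2
    · rintro rfl
      exact ⟨by intro w hw; simp at hw, rfl⟩
  simp [this]

lemma trees_succ (m n : ℕ) : (trees m (n + 1)).card =
    ∑ l ∈ Finset.finsuppAntidiag (Finset.univ : Finset (Fin m)) n,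
      ∏ i, (trees m (l i)).card := by
  classical
  have : trees m (n + 1) = ((Finset.finsuppAntidiag (Finset.univ : Finset (Fin m)) n).biUnion
      (fun l => Fintype.piFinset (fun i => trees m (l i)))).image graft := by
    ext T
    simp only [mem_trees, Finset.mem_image, Finset.mem_biUnion, Fintype.mem_piFinset,
      Finset.mem_finsuppAntidiag]
    constructor
    · rintro ⟨hT, hc⟩
      have hne : T.Nonempty := by rw [← Finset.card_pos]; omega
      obtain ⟨w, hw⟩ := hne
      obtain ⟨f, rfl⟩ := exists_graft T (hT w hw [] List.nil_prefix)
      rw [isTree_graft] at hT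
      rw [card_graft] at hc
      refine ⟨f, ⟨Finsupp.equivFunOnFinite.symm (fun i => (f i).card), ⟨?_, ?_⟩, ?_⟩, rfl⟩
      · simpa using hc
      · simp
      · intro i
        exact ⟨hT i, by simp⟩
    · rintro ⟨f, ⟨l, ⟨hl, -⟩, hf⟩, rfl⟩
      rw [isTree_graft, card_graft]
      refine ⟨fun i => (hf i).1, ?_⟩
      rw [← hl]
      simp [fun i => (hf i).2]
  rw [this, Finset.card_image_of_injective _ graft_injective, Finset.card_biUnion]
  · simp
  · intro a _ b _ hab
    refine Finset.disjoint_left.2 ?_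
    intro f hfa hfb
    apply hab
    ext i
    rw [Fintype.mem_piFinset] at hfa hfb
    rw [← (mem_trees.1 (hfa i)).2, ← (mem_trees.1 (hfb i)).2]

noncomputable def treeSeries (m : ℕ) : PowerSeries ℤ :=
  PowerSeries.mk fun n => ((trees m n).card : ℤ)

lemma treeSeries_eq (m : ℕ) :
    treeSeries m = 1 + PowerSeries.X * treeSeries m ^ m := by
  ext n
  cases n with
  | zero => simp [treeSeries, trees_zero]
  | succ n =>
    have h : treeSeries m ^ m = ∏ _i : Fin m, treeSeries m := by simp
    rw [map_add, PowerSeries.coeff_succ_X_mul, h, PowerSeries.coeff_prod]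
    simp [treeSeries, trees_succ, PowerSeries.coeff_one]

lemma coeff_rec (m k n : ℕ) : PowerSeries.coeff (n + 1) (treeSeries m ^ (k + 1)) =
    PowerSeries.coeff (n + 1) (treeSeries m ^ k) +
      PowerSeries.coeff n (treeSeries m ^ (k + m)) := by
  have : treeSeries m ^ (k + 1) =
      treeSeries m ^ k + PowerSeries.X * treeSeries m ^ (k + m) := by
    rw [pow_succ]
    nth_rewrite 2 [treeSeries_eq]
    ring
  rw [this, map_add, PowerSeries.coeff_succ_X_mul]

lemma coeff_zero_pow (m k : ℕ) : PowerSeries.coeff 0 (treeSeries m ^ k) = 1 := by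
  simp [treeSeries, trees_zero]

lemma coeff_formula (m : ℕ) (hm : 1 ≤ m) (n : ℕ) : ∀ k : ℕ,
    ((m * n + k : ℕ) : ℤ) * PowerSeries.coeff n (treeSeries m ^ k)
      = k * ((m * n + k).choose n : ℤ) := by
  induction n with
  | zero => intro k; rw [coeff_zero_pow]; simp
  | succ n ih =>
    intro k
    induction k with
    | zero => simp [PowerSeries.coeff_one]
    | succ k ihk =>
      have h1 := ih (k + m)
      rw [show m * n + (k + m) = m * (n + 1) + k by ring] at h1
      rw [coeff_rec, ← add_assoc, Nat.choose_succ_succ]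
      obtain ⟨N, hN⟩ : ∃ N, N = m * (n + 1) + k := ⟨_, rfl⟩
      rw [← hN] at h1 ihk ⊢
      have hpos : (N : ℤ) ≠ 0 := by
        have : 0 < m * (n + 1) := by positivity
        exact_mod_cast (by omega : N ≠ 0)
      have h2 := Nat.add_one_mul_choose_eq N n
      rw [Nat.choose_succ_succ] at h2
      have hN' : (N : ℤ) = m * (n + 1) + k := by exact_mod_cast hN
      generalize PowerSeries.coeff (n + 1) (treeSeries m ^ k) = a at *
      generalize PowerSeries.coeff n (treeSeries m ^ (k + m)) = b at *
      simp only [Nat.succ_eq_add_one] at *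
      generalize N.choose n = x at *
      generalize N.choose (n + 1) = y at *
      apply mul_left_cancel₀ hpos
      zify at h2
      push_cast at *
      have e : ((N:ℤ) + 1) * (k * y + (k + m) * x) = N * ((k + 1) * (x + y)) := by
        linear_combination (m : ℤ) * h2 - (x + y : ℤ) * hN' + x * hN' - x * hN'
      linear_combination ((N:ℤ) + 1) * ihk + ((N:ℤ) + 1) * h1 + e

/-- The number of `m`-ary trees with exactly `n` nodes equals
`binom(mn, n) / ((m−1)n + 1)`. -/
theorem stmt0 (m n : ℕ) (hm : 1 ≤ m) :
    ((m - 1) * n + 1) * Set.ncard {T : Finset (List (Fin m)) | IsTree T ∧ T.card = n}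
      = (m * n).choose n := by
  have h0 : Set.ncard {T : Finset (List (Fin m)) | IsTree T ∧ T.card = n} = (trees m n).card :=
    Set.ncard_eq_toFinset_card _ (treeSet_finite m n)
  rw [h0]
  have h := coeff_formula m hm n 1
  simp only [pow_one, treeSeries, PowerSeries.coeff_mk, Nat.cast_one, one_mul] at h
  have h' : (m * n + 1) * (trees m n).card = (m * n + 1).choose n := by exact_mod_cast h
  have h2 := Nat.choose_mul_succ_eq (m * n) n
  obtain ⟨p, rfl⟩ : ∃ p, m = p + 1 := ⟨m - 1, by omega⟩
  rw [show (p + 1) * n + 1 - n = p * n + 1 by rw [add_mul]; omega, ← h'] at h2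
  simp only [Nat.add_sub_cancel]
  apply Nat.eq_of_mul_eq_mul_right (Nat.succ_pos ((p + 1) * n))
  rw [Nat.succ_eq_add_one, h2]
  ring
end

section
/- Let m ≥ 1 and n ≥ 1. Every orbit of the cyclic group C_n acting on U_n by cyclic shift contains at least one admissible sequence. -/
/-- `U_n`: sequences of `n` nonnegative integers summing to `(m−1)n`. -/
def USet (m n : ℕ) : Set (List ℕ) := {a | a.length = n ∧ a.sum = (m - 1) * n}

/-- Admissibility: `a₁+…+a_i ≤ (m−1)i` for all `i = 1,…,n`. -/
def Admissible (m : ℕ) (a : List ℕ) : Prop := ∀ i ≤ a.length, (a.take i).sum ≤ (m - 1) * i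

/-- Every orbit of the cyclic group `C_n` acting on `U_n` by cyclic shift contains at
least one admissible sequence: every `a ∈ U_n` has an admissible cyclic shift. -/
theorem stmt9 (m n : ℕ) (hm : 1 ≤ m) (hn : 1 ≤ n) :
    ∀ a ∈ USet m n, ∃ b, (∃ i, b = a.rotate i) ∧ Admissible m b := by
  rintro a ⟨hlen, hsum⟩
  unfold Admissible
  generalize m - 1 = c at *
  obtain ⟨k, hk, hmax⟩ := Finset.exists_max_image (Finset.range (n + 1))
    (fun k => ((a.take k).sum : ℤ) - c * k) ⟨0, by simp⟩
  have hkn : k ≤ n := by simpa [Nat.lt_succ_iff] using hk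
  have key : ∀ j ≤ n, ((a.take j).sum : ℤ) - c * j ≤ ((a.take k).sum : ℤ) - c * k :=
    fun j hj => hmax j (by simpa [Nat.lt_succ_iff] using hj)
  refine ⟨a.rotate k, ⟨k, rfl⟩, ?_⟩
  intro i hi
  rw [List.length_rotate, hlen] at hi
  rw [List.rotate_eq_drop_append_take (by omega), List.take_append, List.sum_append,
    List.length_drop, hlen, List.take_take]
  have htot : (a.take k).sum + (a.drop k).sum = c * n := by
    rw [← List.sum_append, List.take_append_drop, hsum]
  by_cases h : i ≤ n - k
  · have h1 := key (k + i) (by omega)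
    rw [List.take_add, List.sum_append] at h1
    have h0 : i - (n - k) = 0 := by omega
    simp only [h0, Nat.zero_min, List.take_zero, List.sum_nil, add_zero]
    zify
    push_cast at h1
    linarith
  · have h1 := key (i - (n - k)) (by omega)
    have h2 : ((i - (n - k) : ℕ) : ℤ) = i - (n - k) := by omega
    rw [h2] at h1
    rw [List.take_of_length_le (by rw [List.length_drop]; omega), min_eq_left (by omega)]
    zify at htot ⊢
    push_cast at h1
    linarith
end

section
/- Let m ≥ 1 and n ≥ 1 and let a = (a₁,…,a_n) ∈ U_n. Then for every i = 1,…,n one has wt(a_{i+1},…,a_n,a₁,…,a_i) = wt(a₁,…,a_n) − n·((m−1)i − (a₁+…+a_i)); in particular wt is invariant modulo n under cyclic shift. Moreover, if a is the (n/d)-fold repetition of a sequence b ∈ U_d for a divisor d of n, then wt(a) = (n/d)·wt(b). -/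
/-- The weight `wt(a) = ∑_{i=1}^n (n−i)(m−1−a_i)` of a sequence of length `n`. -/
def wtZ (m : ℕ) (a : List ℕ) : ℤ :=
  ∑ i ∈ Finset.range a.length, ((a.length : ℤ) - 1 - i) * ((m : ℤ) - 1 - a.getD i 0)

theorem wtZ_cons_aux (m x : ℕ) (l : List ℕ) :
    wtZ m (x :: l) = (l.length : ℤ) * ((m : ℤ) - 1 - x) + wtZ m l := by
  unfold wtZ
  rw [List.length_cons, Finset.sum_range_succ', add_comm]
  congr 1
  · simp
  · apply Finset.sum_congr rfl
    intro i _
    simp only [List.getD_cons_succ]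
    push_cast
    ring

theorem wtZ_append_aux (m : ℕ) (l₁ l₂ : List ℕ) :
    wtZ m (l₁ ++ l₂) = wtZ m l₁
      + (l₂.length : ℤ) * (((m : ℤ) - 1) * l₁.length - (l₁.sum : ℤ)) + wtZ m l₂ := by
  induction l₁ with
  | nil => simp [wtZ]
  | cons x l ih =>
    rw [List.cons_append, wtZ_cons_aux, wtZ_cons_aux, ih]
    simp only [List.length_append, List.length_cons, List.sum_cons]
    push_cast
    ring

theorem wtZ_repl_aux (m : ℕ) (b : List ℕ) (hb : (b.sum : ℤ) = ((m : ℤ) - 1) * b.length) (k : ℕ) :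
    wtZ m (List.replicate k b).flatten = (k : ℤ) * wtZ m b := by
  induction k with
  | zero => simp [wtZ]
  | succ k ih =>
    rw [List.replicate_succ, List.flatten_cons, wtZ_append_aux, ih, hb]
    push_cast
    ring

/-- The cyclic-shift formula for the weight, invariance of the weight modulo `n` under
cyclic shifts, and multiplicativity of the weight under repetition. -/
theorem stmt11 (m n : ℕ) (hm : 1 ≤ m) (hn : 1 ≤ n) (a : List ℕ) (ha : a ∈ USet m n) :
    (∀ i ≤ n, wtZ m (a.rotate i)
        = wtZ m a - (n : ℤ) * (((m : ℤ) - 1) * i - ((a.take i).sum : ℤ)))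
    ∧ (∀ i : ℕ, (n : ℤ) ∣ wtZ m (a.rotate i) - wtZ m a)
    ∧ ∀ d, d ∣ n → ∀ b ∈ USet m d, a = (List.replicate (n / d) b).flatten →
        wtZ m a = ((n / d : ℕ) : ℤ) * wtZ m b := by
  obtain ⟨hl, hs⟩ := ha
  have key : ∀ i ≤ n, wtZ m (a.rotate i)
        = wtZ m a - (n : ℤ) * (((m : ℤ) - 1) * i - ((a.take i).sum : ℤ)) := by
    intro i hi
    have h1 : wtZ m a = wtZ m (a.take i ++ a.drop i) := by rw [List.take_append_drop]
    rw [List.rotate_eq_drop_append_take (by omega), h1, wtZ_append_aux, wtZ_append_aux]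
    have hsum : ((a.take i).sum : ℤ) + ((a.drop i).sum : ℤ) = ((m : ℤ) - 1) * n := by
      have h2 : (a.take i).sum + (a.drop i).sum = (m - 1) * n := by
        rw [← List.sum_append, List.take_append_drop, hs]
      have h3 : (((a.take i).sum + (a.drop i).sum : ℕ) : ℤ) = (((m - 1) * n : ℕ) : ℤ) := by
        rw [h2]
      rw [Nat.cast_add, Nat.cast_mul, Nat.cast_sub hm, Nat.cast_one] at h3
      exact h3
    have e1 : ((a.take i).length : ℤ) = i := by
      rw [List.length_take, hl, min_eq_left hi]
    have e2 : ((a.drop i).length : ℤ) = (n : ℤ) - i := by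
      rw [List.length_drop, hl, Nat.cast_sub hi]
    rw [e1, e2]
    linear_combination (-(i : ℤ)) * hsum
  refine ⟨key, ?_, ?_⟩
  · intro i
    rw [← List.rotate_mod, hl, key (i % n) (Nat.mod_lt _ hn).le]
    refine ⟨-(((m : ℤ) - 1) * (i % n : ℕ) - ((a.take (i % n)).sum : ℤ)), ?_⟩
    ring
  · rintro d - b ⟨hbl, hbs⟩ rfl
    apply wtZ_repl_aux
    rw [hbs, hbl]
    push_cast [Nat.cast_sub hm]
    ring
end

section
/- Let m ≥ 1 and n ≥ 1. In the polynomial ring ℤ[q], the polynomial q^n − 1 divides n·Q̄_n(q) − ∑_{d | n} μ(n/d)·P_d(q^{n/d}), where μ is the Möbius function. -/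
/-- A sequence is primitive if it differs from all of its proper cyclic shifts. -/
def Primitive (a : List ℕ) : Prop := ∀ i, 0 < i → i < a.length → a.rotate i ≠ a

/-- `U_n^{prim}`: the primitive sequences in `U_n`. -/
def UPrim (m n : ℕ) : Set (List ℕ) := {a ∈ USet m n | Primitive a}

/-- The `C_n`-orbit (cyclic class) of a sequence. -/
def rotClass (a : List ℕ) : Set (List ℕ) := {b | ∃ i, b = a.rotate i}

/-- The set of `C_n`-orbits on a shift-invariant set `S`. -/
def orbitsOn (S : Set (List ℕ)) : Set (Set (List ℕ)) := {O | ∃ a ∈ S, O = rotClass a}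

/-- The weight of a cyclic class: the maximal weight of its elements. -/
noncomputable def wtOrb (m : ℕ) (O : Set (List ℕ)) : ℤ := sSup (wtZ m '' O)

/-- `P_n(q^k) = ∑_{a ∈ U_n} q^{k·wt(a)}`, as a Laurent polynomial in `q`. -/
noncomputable def Pscaled (m n k : ℕ) : LaurentPolynomial ℤ :=
  ∑ᶠ a ∈ USet m n, LaurentPolynomial.T ((k : ℤ) * wtZ m a)

/-- `Q̄_n(q) = ∑_{C ∈ U_n^{prim}/C_n} q^{wt(C)}`, as a Laurent polynomial in `q`. -/
noncomputable def Qbar (m n : ℕ) : LaurentPolynomial ℤ :=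
  ∑ᶠ O ∈ orbitsOn (UPrim m n), LaurentPolynomial.T (wtOrb m O)

open Finset in
theorem aux_sum (a : List ℕ) : ∑ i ∈ Finset.range a.length, a.getD i 0 = a.sum := by
  induction a with
  | nil => simp
  | cons x l ih =>
    rw [List.length_cons, Finset.sum_range_succ']
    simp only [List.getD_cons_succ, List.getD_cons_zero, ih, List.sum_cons]
    omega

theorem aux_finite (m n : ℕ) : (USet m n).Finite := by
  refine ((Set.finite_Iic (fun _ : Fin n => (m - 1) * n)).image List.ofFn).subset ?_
  rintro a ⟨h1, h2⟩
  subst h1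
  refine ⟨fun i => a[i], ?_, by simp⟩
  intro i
  show a[i] ≤ _
  rw [← h2]
  exact List.le_sum_of_mem (List.getElem_mem _)

theorem aux_sumZ (m n : ℕ) (hm : 1 ≤ m) (a : List ℕ) (ha : a ∈ USet m n) :
    ∑ i ∈ Finset.range a.length, ((m : ℤ) - 1 - a.getD i 0) = 0 := by
  obtain ⟨h1, h2⟩ := ha
  rw [Finset.sum_sub_distrib, ← Nat.cast_sum, aux_sum, h2, h1]
  simp [Nat.cast_sub hm]
  ring

theorem aux_rot_mem (m n : ℕ) (a : List ℕ) (ha : a ∈ USet m n) (i : ℕ) :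
    a.rotate i ∈ USet m n := by
  obtain ⟨h1, h2⟩ := ha
  exact ⟨by simp [h1], by rw [← h2]; exact (List.rotate_perm a i).sum_eq⟩

theorem aux_wt_rot1 (m n : ℕ) (hm : 1 ≤ m) (a : List ℕ) (ha : a ∈ USet m n) :
    (n : ℤ) ∣ wtZ m (a.rotate 1) - wtZ m a := by
  have h0 := aux_sumZ m n hm a ha
  obtain ⟨h1, h2⟩ := ha
  cases a with
  | nil => simp
  | cons x l =>
    rw [List.length_cons, Finset.sum_range_succ'] at h0
    simp only [List.getD_cons_succ, List.getD_cons_zero] at h0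
    have e1 : (x :: l).rotate 1 = l ++ [x] := by simp
    have e2 : wtZ m (l ++ [x]) =
        ∑ i ∈ Finset.range l.length, ((l.length : ℤ) - i) * ((m : ℤ) - 1 - l.getD i 0) := by
      unfold wtZ
      rw [List.length_append, List.length_singleton, Finset.sum_range_succ]
      have : ((l.length + 1 : ℕ) : ℤ) - 1 - l.length = 0 := by push_cast; ring
      rw [this, zero_mul, add_zero]
      refine Finset.sum_congr rfl fun i hi => ?_
      rw [List.getD_append _ _ _ _ (Finset.mem_range.1 hi)]
      push_cast; ring
    have e3 : wtZ m (x :: l) =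
        ∑ i ∈ Finset.range l.length, ((l.length : ℤ) - 1 - i) * ((m : ℤ) - 1 - l.getD i 0)
          + l.length * ((m : ℤ) - 1 - x) := by
      unfold wtZ
      rw [List.length_cons, Finset.sum_range_succ']
      simp only [List.getD_cons_succ, List.getD_cons_zero]
      congr 1
      · refine Finset.sum_congr rfl fun i hi => ?_
        push_cast; ring
      · push_cast; ring
    have e4 : ∑ i ∈ Finset.range l.length, ((l.length : ℤ) - i) * ((m : ℤ) - 1 - l.getD i 0)
        = ∑ i ∈ Finset.range l.length, ((l.length : ℤ) - 1 - i) * ((m : ℤ) - 1 - l.getD i 0)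
          + ∑ i ∈ Finset.range l.length, ((m : ℤ) - 1 - l.getD i 0) := by
      rw [← Finset.sum_add_distrib]
      refine Finset.sum_congr rfl fun i hi => ?_
      ring
    rw [e1, e2, e3, e4]
    refine ⟨-((m : ℤ) - 1 - x), ?_⟩
    rw [← h1, List.length_cons]
    push_cast
    linear_combination h0

theorem aux_wt_rot (m n : ℕ) (hm : 1 ≤ m) (a : List ℕ) (ha : a ∈ USet m n) (i : ℕ) :
    (n : ℤ) ∣ wtZ m (a.rotate i) - wtZ m a := by
  induction i with
  | zero => simp
  | succ i ih =>
    have := aux_wt_rot1 m n hm _ (aux_rot_mem m n a ha i)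
    rw [List.rotate_rotate] at this
    have := dvd_add this ih
    simpa using this

theorem aux_T_dvd_nat (n : ℕ) (k : ℕ) :
    (LaurentPolynomial.T (n : ℤ) - 1 : LaurentPolynomial ℤ) ∣
      LaurentPolynomial.T ((n : ℤ) * k) - 1 := by
  have := sub_dvd_pow_sub_pow (LaurentPolynomial.T (n : ℤ) : LaurentPolynomial ℤ) 1 k
  rw [one_pow, LaurentPolynomial.T_pow] at this
  rwa [mul_comm (n : ℤ)]

theorem aux_T_dvd (n : ℕ) (x y : ℤ) (h : (n : ℤ) ∣ x - y) :
    (LaurentPolynomial.T (n : ℤ) - 1 : LaurentPolynomial ℤ) ∣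
      LaurentPolynomial.T x - LaurentPolynomial.T y := by
  obtain ⟨k, hk⟩ := h
  obtain ⟨j, rfl | rfl⟩ := k.eq_nat_or_neg
  · have : (LaurentPolynomial.T x - LaurentPolynomial.T y : LaurentPolynomial ℤ)
        = (LaurentPolynomial.T ((n : ℤ) * j) - 1) * LaurentPolynomial.T y := by
      rw [sub_mul, one_mul, ← LaurentPolynomial.T_add]
      congr 2; linarith
    rw [this]
    exact (aux_T_dvd_nat n j).mul_right _
  · have : (LaurentPolynomial.T x - LaurentPolynomial.T y : LaurentPolynomial ℤ)
        = (LaurentPolynomial.T ((n : ℤ) * j) - 1) * (- LaurentPolynomial.T x) := by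
      rw [sub_mul, one_mul, mul_neg, ← LaurentPolynomial.T_add]
      have : (n : ℤ) * j + x = y := by linarith
      rw [this]; ring
    rw [this]
    exact (aux_T_dvd_nat n j).mul_right _

theorem aux_iter (k : ℕ) (a : List ℕ) : (fun l : List ℕ => l.rotate 1)^[k] a = a.rotate k := by
  induction k with
  | zero => simp
  | succ k ih => rw [Function.iterate_succ_apply', ih, List.rotate_rotate]

/-- the period of a sequence -/
noncomputable def per (a : List ℕ) : ℕ := Function.minimalPeriod (fun l : List ℕ => l.rotate 1) a

theorem per_dvd_iff (a : List ℕ) (k : ℕ) : per a ∣ k ↔ a.rotate k = a := by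
  unfold per
  rw [← Function.isPeriodicPt_iff_minimalPeriod_dvd, Function.IsPeriodicPt, Function.IsFixedPt,
    aux_iter]

theorem per_dvd_length (a : List ℕ) : per a ∣ a.length :=
  (per_dvd_iff _ _).2 (List.rotate_length a)

theorem prim_iff (a : List ℕ) (h : 0 < a.length) : Primitive a ↔ per a = a.length := by
  have hp : 0 < per a := Nat.pos_of_dvd_of_pos (per_dvd_length a) h
  constructor
  · intro H
    have hle := Nat.le_of_dvd h (per_dvd_length a)
    by_contra hne
    exact H (per a) hp (by omega) ((per_dvd_iff _ _).1 dvd_rfl)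
  · intro H i hi hlt he
    have := Nat.le_of_dvd hi ((per_dvd_iff _ _).2 he)
    omega

/-- the extension of a sequence of length `d` to length `e` by periodicity -/
def pw (d e : ℕ) (b : List ℕ) : List ℕ := (List.range e).map fun i => b.getD (i % d) 0

theorem pw_length (d e : ℕ) (b : List ℕ) : (pw d e b).length = e := by simp [pw]

theorem pw_getD (d e : ℕ) (b : List ℕ) (i : ℕ) (h : i < e) :
    (pw d e b).getD i 0 = b.getD (i % d) 0 := by
  simp [pw, h]

theorem list_ext' (a b : List ℕ) (h : a.length = b.length)
    (H : ∀ i < a.length, a.getD i 0 = b.getD i 0) : a = b := by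
  refine List.ext_getElem h fun i h1 h2 => ?_
  have := H i h1
  rwa [List.getD_eq_getElem _ _ h1, List.getD_eq_getElem _ _ h2] at this

theorem rot_getD (a : List ℕ) (j i : ℕ) (h : i < a.length) :
    (a.rotate j).getD i 0 = a.getD ((i + j) % a.length) 0 := by
  rw [List.getD_eq_getElem _ _ (by simpa using h), List.getElem_rotate, List.getD_eq_getElem]

theorem pw_rot (d e : ℕ) (hd : 0 < d) (he : d ∣ e) (b : List ℕ) (hb : b.length = d) (j : ℕ) :
    (pw d e b).rotate j = pw d e (b.rotate j) := by
  refine list_ext' _ _ (by simp [pw_length]) fun i hi => ?_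
  have hi' : i < e := by simpa [pw_length] using hi
  rw [rot_getD _ _ _ (by simpa [pw_length] using hi'), pw_length, pw_getD _ _ _ _ hi',
    pw_getD _ _ _ _ (Nat.mod_lt _ (by omega)), rot_getD _ _ _ (by rw [hb]; exact Nat.mod_lt _ hd),
    Nat.mod_mod_of_dvd _ he, hb, Nat.mod_add_mod]

theorem pw_inj (d e : ℕ) (hde : d ≤ e) (b c : List ℕ) (hb : b.length = d)
    (hc : c.length = d) (h : pw d e b = pw d e c) : b = c := by
  refine list_ext' _ _ (by omega) fun i hi => ?_
  have := congrArg (fun l : List ℕ => l.getD i 0) h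
  rw [pw_getD _ _ _ _ (by omega), pw_getD _ _ _ _ (by omega), Nat.mod_eq_of_lt (by omega)] at this
  exact this

theorem pw_per (d e : ℕ) (hd : 0 < d) (hde : d ≤ e) (he : d ∣ e) (b : List ℕ)
    (hb : b.length = d) : per (pw d e b) = per b := by
  have key : ∀ k, per (pw d e b) ∣ k ↔ per b ∣ k := fun k => by
    rw [per_dvd_iff, per_dvd_iff, pw_rot d e hd he b hb]
    exact ⟨fun h => pw_inj d e hde _ _ (by simpa using hb) hb h, fun h => by rw [h]⟩
  exact Nat.dvd_antisymm ((key _).2 dvd_rfl) ((key _).1 dvd_rfl)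

theorem pw_take (d e : ℕ) (hd : 0 < d) (hde : d ≤ e) (a : List ℕ) (ha : a.length = e)
    (h : per a = d) : pw d e (a.take d) = a := by
  refine list_ext' _ _ (by simp [pw_length, ha]) fun i hi => ?_
  rw [pw_length] at hi
  have hlt := Nat.mod_lt i hd
  rw [pw_getD _ _ _ _ hi]
  have h1 : (a.take d).getD (i % d) 0 = a.getD (i % d) 0 := by
    simp [List.getD_eq_getElem?_getD, List.getElem?_take, hlt]
  have h2 : a.rotate (d * (i / d)) = a := (per_dvd_iff _ _).1 (by rw [h]; exact dvd_mul_right _ _)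
  rw [h1]
  conv_lhs => rw [← h2]
  rw [rot_getD _ _ _ (by omega), Nat.mod_add_div, ha, Nat.mod_eq_of_lt hi]

theorem sum_periodic {M : Type*} [AddCommMonoid M] (d k : ℕ) (f : ℕ → M) :
    ∑ i ∈ Finset.range (d * k), f i
      = ∑ j ∈ Finset.range k, ∑ i ∈ Finset.range d, f (d * j + i) := by
  induction k with
  | zero => simp
  | succ k ih => rw [Nat.mul_succ, Finset.sum_range_add, ih, Finset.sum_range_succ]

theorem pw_sum (d k : ℕ) (b : List ℕ) (hb : b.length = d) :
    (pw d (d * k) b).sum = k * b.sum := by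
  rw [← aux_sum, ← aux_sum, pw_length, sum_periodic, hb]
  have : ∀ j ∈ Finset.range k, ∑ i ∈ Finset.range d, (pw d (d * k) b).getD (d * j + i) 0
      = ∑ i ∈ Finset.range d, b.getD i 0 := by
    intro j hj
    refine Finset.sum_congr rfl fun i hi => ?_
    rw [Finset.mem_range] at hi hj
    have : d * j + i < d * k := by nlinarith
    rw [pw_getD _ _ _ _ this, Nat.mul_add_mod, Nat.mod_eq_of_lt hi]
  rw [Finset.sum_congr rfl this]
  simp

theorem pw_wt (m d k : ℕ) (hm : 1 ≤ m) (b : List ℕ) (hb : b ∈ USet m d) :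
    wtZ m (pw d (d * k) b) = k * wtZ m b := by
  have h0 := aux_sumZ m d hm b hb
  have hl : b.length = d := hb.1
  unfold wtZ
  rw [pw_length, sum_periodic]
  rw [hl] at h0 ⊢
  have : ∀ j ∈ Finset.range k, ∑ i ∈ Finset.range d,
      (((d * k : ℕ) : ℤ) - 1 - ((d * j + i : ℕ) : ℤ)) *
        ((m : ℤ) - 1 - (pw d (d * k) b).getD (d * j + i) 0)
      = ∑ i ∈ Finset.range d, ((d : ℤ) - 1 - i) * ((m : ℤ) - 1 - b.getD i 0) := by
    intro j hj
    have : ∑ i ∈ Finset.range d,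
      (((d * k : ℕ) : ℤ) - 1 - ((d * j + i : ℕ) : ℤ)) *
        ((m : ℤ) - 1 - (pw d (d * k) b).getD (d * j + i) 0)
      = ∑ i ∈ Finset.range d, (((d : ℤ) - 1 - i) * ((m : ℤ) - 1 - b.getD i 0)
        + ((d : ℤ) * k - d * j - d) * ((m : ℤ) - 1 - b.getD i 0)) := by
      refine Finset.sum_congr rfl fun i hi => ?_
      rw [Finset.mem_range] at hi hj
      have : d * j + i < d * k := by nlinarith
      rw [pw_getD _ _ _ _ this, Nat.mul_add_mod, Nat.mod_eq_of_lt hi]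
      push_cast; ring
    rw [this, Finset.sum_add_distrib, ← Finset.mul_sum, h0]
    ring
  rw [Finset.sum_congr rfl this]
  simp

/-- `U_n` as a finset -/
noncomputable def UF (m n : ℕ) : Finset (List ℕ) := (aux_finite m n).toFinset

/-- primitive part of `U_n` as a finset -/
noncomputable def UPF (m n : ℕ) : Finset (List ℕ) := (UF m n).filter fun a => per a = n

theorem mem_UF (m n : ℕ) (a : List ℕ) : a ∈ UF m n ↔ a ∈ USet m n := by simp [UF]

theorem mem_UPF (m n : ℕ) (a : List ℕ) : a ∈ UPF m n ↔ a ∈ USet m n ∧ per a = n := by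
  simp [UPF, mem_UF]

theorem UPF_coe (m n : ℕ) (hn : 0 < n) : UPrim m n = (UPF m n : Set (List ℕ)) := by
  ext a
  rw [Finset.mem_coe, mem_UPF]
  constructor
  · rintro ⟨h, h'⟩
    refine ⟨h, ?_⟩
    rw [← h.1]; exact (prim_iff a (by rw [h.1]; exact hn)).1 h'
  · rintro ⟨h, h'⟩
    refine ⟨h, ?_⟩
    rw [← h.1] at h'; exact (prim_iff a (by rw [h.1]; exact hn)).2 h'

theorem Pscaled_eq (m n k : ℕ) :
    Pscaled m n k = ∑ a ∈ UF m n, LaurentPolynomial.T ((k : ℤ) * wtZ m a) := by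
  unfold Pscaled
  rw [finsum_mem_eq_finite_toFinset_sum _ (aux_finite m n)]
  rfl

theorem fiber_sum (m d k l : ℕ) (hm : 1 ≤ m) (hd : 0 < d) (hk : 0 < k) :
    ∑ a ∈ UF m (d * k) with per a = d,
      (LaurentPolynomial.T ((l : ℤ) * wtZ m a) : LaurentPolynomial ℤ)
      = ∑ b ∈ UPF m d, LaurentPolynomial.T (((k * l : ℕ) : ℤ) * wtZ m b) := by
  have hde : d ≤ d * k := Nat.le_mul_of_pos_right _ hk
  symm
  refine Finset.sum_bij (fun b _ => pw d (d * k) b) ?_ ?_ ?_ ?_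
  · intro b hb
    rw [mem_UPF] at hb
    rw [Finset.mem_filter, mem_UF, pw_per d _ hd hde (dvd_mul_right _ _) b hb.1.1]
    refine ⟨⟨pw_length _ _ _, ?_⟩, hb.2⟩
    rw [pw_sum d k b hb.1.1, hb.1.2]; ring
  · intro b hb c hc h
    rw [mem_UPF] at hb hc
    exact pw_inj _ _ hde _ _ hb.1.1 hc.1.1 h
  · intro a ha
    rw [Finset.mem_filter, mem_UF] at ha
    obtain ⟨⟨h1, h2⟩, h3⟩ := ha
    have ht := pw_take d (d * k) hd hde a h1 h3
    have hlen : (a.take d).length = d := by simp [h1, hde]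
    refine ⟨a.take d, ?_, ht⟩
    rw [mem_UPF]
    refine ⟨⟨hlen, ?_⟩, ?_⟩
    · have := pw_sum d k (a.take d) hlen
      rw [ht, h2] at this
      refine Nat.eq_of_mul_eq_mul_left hk ?_
      rw [← this]; ring
    · rw [← pw_per d _ hd hde (dvd_mul_right _ _) _ hlen, ht, h3]
  · intro b hb
    rw [mem_UPF] at hb
    rw [pw_wt m d k hm b hb.1]
    congr 1
    push_cast; ring

theorem P_decomp (m n e : ℕ) (hm : 1 ≤ m) (hn : 0 < n) (he : e ∣ n) :
    ∑ d ∈ e.divisors, ∑ b ∈ UPF m d,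
      (LaurentPolynomial.T (((n / d : ℕ) : ℤ) * wtZ m b) : LaurentPolynomial ℤ)
      = Pscaled m e (n / e) := by
  have he0 : 0 < e := Nat.pos_of_dvd_of_pos he hn
  rw [Pscaled_eq, ← Finset.sum_fiberwise_of_maps_to (t := e.divisors) (g := per)]
  · refine Finset.sum_congr rfl fun d hd => ?_
    obtain ⟨k, rfl⟩ := Nat.dvd_of_mem_divisors hd
    have hd0 : 0 < d := Nat.pos_of_mul_pos_right he0
    have hk0 : 0 < k := Nat.pos_of_mul_pos_left he0
    rw [fiber_sum m d k _ hm hd0 hk0]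
    obtain ⟨l, rfl⟩ := he
    rw [Nat.mul_div_cancel_left _ he0, mul_assoc, Nat.mul_div_cancel_left _ hd0]
  · intro a ha
    rw [mem_UF] at ha
    rw [Nat.mem_divisors]
    refine ⟨?_, by omega⟩
    have := per_dvd_length a
    rwa [ha.1] at this

theorem moebius_part (m n : ℕ) (hm : 1 ≤ m) (hn : 0 < n) :
    ∑ d ∈ n.divisors, ((ArithmeticFunction.moebius (n / d) : ℤ) : LaurentPolynomial ℤ)
              * Pscaled m d (n / d) = ∑ b ∈ UPF m n, LaurentPolynomial.T (wtZ m b) := by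
  have := (ArithmeticFunction.sum_eq_iff_sum_mul_moebius_eq_on
    (f := fun d => ∑ b ∈ UPF m d,
      (LaurentPolynomial.T (((n / d : ℕ) : ℤ) * wtZ m b) : LaurentPolynomial ℤ))
    (g := fun e => Pscaled m e (n / e)) {d | d ∣ n} (fun a b h h' => dvd_trans h h')).1
    (fun e _ he => P_decomp m n e hm hn he) n hn dvd_rfl
  rw [Nat.sum_divisorsAntidiagonal'
    (f := fun x y => ((ArithmeticFunction.moebius x : ℤ) : LaurentPolynomial ℤ)
      * Pscaled m y (n / y))] at this
  rw [this]
  simp [Nat.div_self hn]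

theorem rotClass_eq (a : List ℕ) (i : ℕ) : rotClass (a.rotate i) = rotClass a := by
  have h1 : ∀ (a : List ℕ) i, rotClass (a.rotate i) ⊆ rotClass a := by
    rintro a i _ ⟨j, rfl⟩
    exact ⟨i + j, by rw [List.rotate_rotate]⟩
  refine (h1 a i).antisymm ?_
  rintro _ ⟨j, rfl⟩
  obtain ⟨k, hk⟩ := (List.IsRotated.symm ⟨i, rfl⟩ : (a.rotate i) ~r a)
  exact ⟨k + j, by rw [← List.rotate_rotate, hk]⟩

theorem per_rot (a : List ℕ) (i : ℕ) : per (a.rotate i) = per a := by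
  have key : ∀ k, per (a.rotate i) ∣ k ↔ per a ∣ k := fun k => by
    rw [per_dvd_iff, per_dvd_iff, List.rotate_rotate, add_comm, ← List.rotate_rotate,
      List.rotate_eq_rotate]
  exact Nat.dvd_antisymm ((key _).2 dvd_rfl) ((key _).1 dvd_rfl)

theorem rot_mod (a : List ℕ) (n : ℕ) (h : a.length = n) (j : ℕ) :
    a.rotate j = a.rotate (j % n) := by rw [← h, List.rotate_mod]

theorem rot_injOn (a : List ℕ) (n : ℕ) (h : per a = n) :
    Set.InjOn (fun i => a.rotate i) (Finset.range n : Set ℕ) := by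
  have key : ∀ i j, i ≤ j → j < n → a.rotate i = a.rotate j → i = j := by
    intro i j hij hj he
    have h1 : j = (j - i) + i := by omega
    rw [h1, ← List.rotate_rotate, List.rotate_eq_rotate] at he
    have := (per_dvd_iff _ _).2 he.symm
    rw [h] at this
    have := Nat.eq_zero_of_dvd_of_lt this (by omega)
    omega
  intro i hi j hj he
  simp only [Finset.coe_range, Set.mem_Iio] at hi hj he
  rcases le_total i j with hij | hij
  · exact key i j hij hj he
  · exact (key j i hij hi he.symm).symm

open Classical in
theorem orbit_part (m n : ℕ) (hm : 1 ≤ m) (hn : 0 < n) :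
    (LaurentPolynomial.T (n : ℤ) - 1 : LaurentPolynomial ℤ) ∣
      (n : LaurentPolynomial ℤ) * Qbar m n - ∑ b ∈ UPF m n, LaurentPolynomial.T (wtZ m b) := by
  have hQ : Qbar m n = ∑ O ∈ (UPF m n).image rotClass, LaurentPolynomial.T (wtOrb m O) := by
    unfold Qbar
    rw [← finsum_mem_coe_finset]
    have : orbitsOn (UPrim m n) = (((UPF m n).image rotClass : Finset _) : Set (Set (List ℕ))) := by
      rw [UPF_coe m n hn]
      ext O
      simp only [orbitsOn, Set.mem_setOf_eq, Finset.coe_image, Set.mem_image]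
      exact exists_congr fun a => and_congr_right fun _ => eq_comm
    rw [this]
  rw [hQ, ← Finset.sum_fiberwise_of_maps_to (t := (UPF m n).image rotClass) (g := rotClass)
    (fun a ha => Finset.mem_image_of_mem _ ha), Finset.mul_sum, ← Finset.sum_sub_distrib]
  refine Finset.dvd_sum fun O hO => ?_
  obtain ⟨a, ha, rfl⟩ := Finset.mem_image.1 hO
  rw [mem_UPF] at ha
  obtain ⟨hU, hp⟩ := ha
  have hfib : (UPF m n).filter (fun b => rotClass b = rotClass a)
      = (Finset.range n).image (fun i => a.rotate i) := by
    ext b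
    simp only [Finset.mem_filter, Finset.mem_image, Finset.mem_range]
    constructor
    · rintro ⟨hb, hab⟩
      have : b ∈ rotClass a := by rw [← hab]; exact ⟨0, by simp⟩
      obtain ⟨j, rfl⟩ := this
      exact ⟨j % n, Nat.mod_lt _ hn, (rot_mod a n hU.1 j).symm⟩
    · rintro ⟨i, hi, rfl⟩
      rw [mem_UPF]
      exact ⟨⟨aux_rot_mem m n a hU i, by rw [per_rot, hp]⟩, rotClass_eq a i⟩
  rw [hfib, Finset.sum_image (rot_injOn a n hp)]
  have hmem : wtOrb m (rotClass a) ∈ wtZ m '' rotClass a := by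
    refine Set.Nonempty.csSup_mem ⟨_, a, ⟨0, by simp⟩, rfl⟩ (Set.Finite.image _ ?_)
    refine (aux_finite m n).subset ?_
    rintro _ ⟨j, rfl⟩
    exact aux_rot_mem m n a hU j
  obtain ⟨_, ⟨j, rfl⟩, hj⟩ := hmem
  have hc : (n : LaurentPolynomial ℤ) * LaurentPolynomial.T (wtOrb m (rotClass a))
      = ∑ i ∈ Finset.range n, LaurentPolynomial.T (wtOrb m (rotClass a)) := by
    simp
  rw [hc, ← Finset.sum_sub_distrib]
  refine Finset.dvd_sum fun i _ => aux_T_dvd n _ _ ?_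
  rw [← hj]
  have := dvd_sub (aux_wt_rot m n hm a hU j) (aux_wt_rot m n hm a hU i)
  simpa using this

/-- `q^n − 1` divides `n·Q̄_n(q) − ∑_{d ∣ n} μ(n/d)·P_d(q^{n/d})`. -/
theorem stmt12 (m n : ℕ) (hm : 1 ≤ m) (hn : 1 ≤ n) :
    (LaurentPolynomial.T (n : ℤ) - 1) ∣
      ((n : LaurentPolynomial ℤ) * Qbar m n
        - ∑ d ∈ n.divisors,
            ((ArithmeticFunction.moebius (n / d) : ℤ) : LaurentPolynomial ℤ)
              * Pscaled m d (n / d)) := by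
  rw [moebius_part m n hm hn]
  exact orbit_part m n hm hn
end

section
/- Let m ≥ 1 and n ≥ 1. The polynomial Q_n(q) ∈ ℤ[q] is divisible in ℤ[q] by [n] = 1 + q + … + q^{n−1}, i.e. the quotient Q_n(q)/[n] is a polynomial with integer coefficients. -/
/-- `U_n^{prim,+}`: equal to `U_n^{prim}`, together with the twofold repetitions `bb` of
primitive sequences `b ∈ U_{n/2}^{prim}` when `m` is even and `n ≡ 2 mod 4`. -/
def UPrimPlus (m n : ℕ) : Set (List ℕ) :=
  UPrim m n ∪ {a | Even m ∧ n % 4 = 2 ∧ ∃ b ∈ UPrim m (n / 2), a = b ++ b}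

/-- `Q_n(q) = ∑_{C ∈ U_n^{prim,+}/C_n} q^{wt(C)}`, as a Laurent polynomial in `q`. -/
noncomputable def Qplus (m n : ℕ) : LaurentPolynomial ℤ :=
  ∑ᶠ O ∈ orbitsOn (UPrimPlus m n), LaurentPolynomial.T (wtOrb m O)

open Finset Classical in
noncomputable def h14UF (m n : ℕ) : Finset (ℕ → ℕ) :=
  (finsuppAntidiag (range n) ((m - 1) * n)).image (fun l i => l (i % n))

def h14sh (f : ℕ → ℕ) : ℕ → ℕ := fun i => f (i + 1)

def h14W (m n : ℕ) (f : ℕ → ℕ) : ℤ :=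
  ∑ i ∈ Finset.range n, ((n : ℤ) - 1 - i) * ((m : ℤ) - 1 - f i)

theorem h14sh_iter (k : ℕ) (f : ℕ → ℕ) (i : ℕ) : h14sh^[k] f i = f (i + k) := by
  induction k generalizing f with
  | zero => rfl
  | succ k ih => rw [Function.iterate_succ_apply, ih]; simp [h14sh, add_assoc]

theorem h14per_iff (n : ℕ) (f : ℕ → ℕ) :
    Function.IsPeriodicPt h14sh n f ↔ ∀ i, f (i + n) = f i := by
  constructor
  · intro h i
    have := h14sh_iter n f i
    rw [h] at this
    exact this.symm
  · intro h
    funext i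
    rw [h14sh_iter, h]

theorem h14per_mod {n : ℕ} {f : ℕ → ℕ} (h : Function.IsPeriodicPt h14sh n f) (i : ℕ) :
    f (i % n) = f i := by
  have h' : Function.Periodic f n := (h14per_iff n f).1 h
  exact h'.map_mod_nat i

open Finset in
theorem h14mem_UF {m n : ℕ} {f : ℕ → ℕ} (hn : 0 < n) :
    f ∈ h14UF m n ↔ Function.IsPeriodicPt h14sh n f ∧ ∑ i ∈ range n, f i = (m - 1) * n := by
  classical
  constructor
  · intro h
    obtain ⟨l, hl, rfl⟩ := mem_image.1 h
    rw [mem_finsuppAntidiag] at hl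
    refine ⟨(h14per_iff _ _).2 (fun i => by simp), ?_⟩
    rw [← hl.1]
    exact sum_congr rfl fun i hi => by simp only [Nat.mod_eq_of_lt (mem_range.1 hi)]
  · rintro ⟨h, hs⟩
    refine mem_image.2 ⟨Finsupp.onFinset (range n) (fun i => if i < n then f i else 0) ?_, ?_, ?_⟩
    · intro a ha
      by_contra hc
      simp at hc
      simp [not_lt.2 hc] at ha
    · rw [mem_finsuppAntidiag]
      refine ⟨?_, Finsupp.support_onFinset_subset⟩
      rw [← hs]
      exact sum_congr rfl fun i hi => by simp [mem_range.1 hi]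
    · funext i
      simp [Nat.mod_lt _ hn, h14per_mod h]

open Finset in
theorem h14sum_UF {m n : ℕ} (g : ℕ → ℕ → ℂ) :
    ∑ f ∈ h14UF m n, ∏ i ∈ range n, g i (f i)
      = ∑ l ∈ finsuppAntidiag (range n) ((m - 1) * n), ∏ i ∈ range n, g i (l i) := by
  classical
  unfold h14UF
  rw [sum_image]
  · refine sum_congr rfl fun l _ => prod_congr rfl fun i hi => ?_
    simp only [Nat.mod_eq_of_lt (mem_range.1 hi)]
  · intro l hl l' hl' h
    simp only [mem_coe, mem_finsuppAntidiag] at hl hl'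
    ext i
    by_cases hi : i < n
    · have := congrFun h i
      simpa [Nat.mod_eq_of_lt hi] using this
    · have h1 : l i = 0 := by
        by_contra hc
        exact hi (mem_range.1 (hl.2 (Finsupp.mem_support_iff.2 hc)))
      have h2 : l' i = 0 := by
        by_contra hc
        exact hi (mem_range.1 (hl'.2 (Finsupp.mem_support_iff.2 hc)))
      rw [h1, h2]

theorem h14geom (c : ℂ) :
    (PowerSeries.mk fun j => c ^ j) * (1 - PowerSeries.C c * PowerSeries.X) = 1 := by
  ext j
  rw [mul_sub, mul_one, ← mul_assoc, mul_comm _ (PowerSeries.C c)]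
  cases j with
  | zero => simp
  | succ j => 
    rw [map_sub, PowerSeries.coeff_succ_mul_X]
    simp [PowerSeries.coeff_one, pow_succ']

open Finset in
theorem h14prod_d {d : ℕ} {ζ : ℂ} (hd : 0 < d) (hζ : IsPrimitiveRoot ζ d) :
    ∏ i ∈ range d, (1 - PowerSeries.C (ζ ^ i) * PowerSeries.X : PowerSeries ℂ)
      = 1 - PowerSeries.X ^ d := by
  have h1 : IsPrimitiveRoot (PowerSeries.C ζ : PowerSeries ℂ) d :=
    hζ.map_of_injective PowerSeries.C_injective
  have h2 := h1.pow_sub_pow_eq_prod_sub_mul (1 : PowerSeries ℂ) PowerSeries.X hd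
  rw [one_pow] at h2
  rw [h2]
  have : NeZero d := ⟨hd.ne'⟩
  symm
  refine (prod_bij (fun i _ => (PowerSeries.C ζ : PowerSeries ℂ) ^ i) ?_ ?_ ?_ ?_).symm
  · intro i _
    rw [Polynomial.mem_nthRootsFinset hd, ← pow_mul, mul_comm, pow_mul, h1.pow_eq_one, one_pow]
  · intro i hi j hj h
    exact h1.pow_inj (mem_range.1 hi) (mem_range.1 hj) h
  · intro x hx
    rw [Polynomial.mem_nthRootsFinset hd] at hx
    obtain ⟨i, hi, rfl⟩ := h1.eq_pow_of_pow_eq_one hx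
    exact ⟨i, mem_range.2 hi, rfl⟩
  · intro i _
    rw [map_pow]

open Finset in
theorem h14prod_dk {d : ℕ} {ζ : ℂ} (hd : 0 < d) (hζ : IsPrimitiveRoot ζ d) (k : ℕ) :
    ∏ i ∈ range (d * k), (1 - PowerSeries.C (ζ ^ i) * PowerSeries.X : PowerSeries ℂ)
      = (1 - PowerSeries.X ^ d) ^ k := by
  induction k with
  | zero => simp
  | succ k ih =>
    rw [mul_add, mul_one, prod_range_add, ih, pow_succ, ← h14prod_d hd hζ]
    congr 1
    refine prod_congr rfl fun i _ => ?_
    rw [pow_add ζ, pow_mul, hζ.pow_eq_one, one_pow, one_mul]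

open Finset in
theorem h14key {m d k : ℕ} {ζ : ℂ} (hd : 0 < d) (hζ : IsPrimitiveRoot ζ d) :
    ∑ f ∈ h14UF m (d * k), ∏ i ∈ range (d * k), (ζ ^ i) ^ (f i) = ((h14UF m k).card : ℂ) := by
  rw [h14sum_UF (fun i j => (ζ ^ i) ^ j)]
  have hc : ((h14UF m k).card : ℂ) = ∑ f ∈ h14UF m k, ∏ i ∈ range k, (fun _ _ => (1 : ℂ)) i (f i) := by
    simp
  rw [hc, h14sum_UF (fun _ _ => (1 : ℂ))]
  set G : PowerSeries ℂ := ∏ i ∈ range (d * k), PowerSeries.mk fun j => (ζ ^ i) ^ j with hG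
  set E : PowerSeries ℂ := ∏ i ∈ range k, PowerSeries.mk fun _ => (1 : ℂ) with hE
  have hG1 : PowerSeries.coeff ((m - 1) * (d * k)) G = ∑ l ∈ finsuppAntidiag (range (d * k)) ((m - 1) * (d * k)),
      ∏ i ∈ range (d * k), (ζ ^ i) ^ (l i) := by
    rw [hG, PowerSeries.coeff_prod]
    simp
  have hE1 : PowerSeries.coeff ((m - 1) * k) E = ∑ l ∈ finsuppAntidiag (range k) ((m - 1) * k),
      ∏ i ∈ range k, (1 : ℂ) := by
    rw [hE, PowerSeries.coeff_prod]
    simp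
  rw [← hG1, ← hE1]
  have h1 : G * (1 - PowerSeries.X ^ d) ^ k = 1 := by
    rw [← h14prod_dk hd hζ, hG, ← prod_mul_distrib]
    exact prod_eq_one fun i _ => h14geom _
  have h2 : E * (1 - PowerSeries.X) ^ k = 1 := by
    have : (1 - PowerSeries.X : PowerSeries ℂ) ^ k = ∏ i ∈ range k, (1 - PowerSeries.X) := by simp
    rw [this, hE, ← prod_mul_distrib]
    refine prod_eq_one fun i _ => ?_
    have := h14geom 1
    simpa using this
  have h3 : PowerSeries.expand d hd.ne' E * (1 - PowerSeries.X ^ d) ^ k = 1 := by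
    have := congrArg (PowerSeries.expand d hd.ne') h2
    simpa using this
  have h4 : G = PowerSeries.expand d hd.ne' E := by
    calc G = G * (PowerSeries.expand d hd.ne' E * (1 - PowerSeries.X ^ d) ^ k) := by rw [h3, mul_one]
      _ = PowerSeries.expand d hd.ne' E * (G * (1 - PowerSeries.X ^ d) ^ k) := by ring
      _ = _ := by rw [h1, mul_one]
  rw [h4, show (m - 1) * (d * k) = d * ((m - 1) * k) by ring, PowerSeries.coeff_expand_mul]

open Finset Classical in
noncomputable def h14PF (m n : ℕ) : Finset (ℕ → ℕ) :=
  (h14UF m n).filter (fun f => Function.minimalPeriod h14sh f = n)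

noncomputable def h14N (m n : ℕ) (ζ : ℂ) : ℂ := ∑ f ∈ h14UF m n, ζ ^ h14W m n f

noncomputable def h14P (m n : ℕ) (ζ : ℂ) : ℂ := ∑ f ∈ h14PF m n, ζ ^ h14W m n f

theorem h14mem_PF {m n : ℕ} {f : ℕ → ℕ} (hn : 0 < n) :
    f ∈ h14PF m n ↔ Function.minimalPeriod h14sh f = n ∧
      ∑ i ∈ Finset.range n, f i = (m - 1) * n := by
  unfold h14PF
  rw [Finset.mem_filter, h14mem_UF hn]
  constructor
  · rintro ⟨⟨_, h⟩, h'⟩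
    exact ⟨h', h⟩
  · rintro ⟨h, h'⟩
    refine ⟨⟨?_, h'⟩, h⟩
    have := Function.isPeriodicPt_minimalPeriod h14sh f
    rwa [h] at this

open Finset in
theorem h14sum_mul {M : Type*} [Semiring M] {e : ℕ} {b : ℕ → M} (hb : ∀ i, b (i + e) = b i)
    (k : ℕ) : ∑ i ∈ range (e * k), b i = k * ∑ i ∈ range e, b i := by
  induction k with
  | zero => simp
  | succ k ih =>
    rw [mul_add, mul_one, sum_range_add, ih]
    have hp : Function.Periodic b e := hb
    have : ∀ j, b (e * k + j) = b j := fun j => by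
      rw [add_comm, mul_comm]; exact hp.nat_mul k j
    simp only [this]
    push_cast
    rw [add_mul, one_mul]

open Finset in
theorem h14wt_mul {e : ℕ} {b : ℕ → ℤ} (hb : ∀ i, b (i + e) = b i)
    (h0 : ∑ i ∈ range e, b i = 0) (k : ℕ) :
    ∑ i ∈ range (e * k), (((e * k : ℕ) : ℤ) - 1 - i) * b i
      = k * ∑ i ∈ range e, ((e : ℤ) - 1 - i) * b i := by
  induction k with
  | zero => simp
  | succ k ih =>
    rw [mul_add, mul_one, sum_range_add]
    have hp : Function.Periodic b e := hb
    have h1 : ∀ j, b (e * k + j) = b j := fun j => by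
      rw [add_comm, mul_comm]; exact hp.nat_mul k j
    simp only [h1]
    have h2 : ∑ i ∈ range (e * k), (((e * k + e : ℕ) : ℤ) - 1 - i) * b i
        = ∑ i ∈ range (e * k), (((e * k : ℕ) : ℤ) - 1 - i) * b i
          + e * ∑ i ∈ range (e * k), b i := by
      rw [mul_sum, ← sum_add_distrib]
      refine sum_congr rfl fun i _ => ?_
      push_cast; ring
    rw [h2, ih, h14sum_mul hb, h0, Nat.cast_succ, add_mul, one_mul]
    simp only [mul_zero, add_zero]
    congr 1
    refine sum_congr rfl fun i _ => ?_
    push_cast; ring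

open Finset in
theorem h14bsum {m n : ℕ} (hm : 1 ≤ m) {f : ℕ → ℕ} (h : ∑ i ∈ range n, f i = (m - 1) * n) :
    ∑ i ∈ range n, ((m : ℤ) - 1 - f i) = 0 := by
  rw [sum_sub_distrib]
  have : ∑ i ∈ range n, (f i : ℤ) = ((m : ℤ) - 1) * n := by
    rw [← Nat.cast_sum, h]
    push_cast [hm]
    ring
  rw [this]
  simp
  ring

theorem h14W_mul {m e : ℕ} (hm : 1 ≤ m) {f : ℕ → ℕ}
    (hp : Function.IsPeriodicPt h14sh e f)
    (h : ∑ i ∈ Finset.range e, f i = (m - 1) * e) (k : ℕ) :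
    h14W m (e * k) f = k * h14W m e f := by
  unfold h14W
  refine h14wt_mul (b := fun i => (m : ℤ) - 1 - f i) (fun i => ?_) (h14bsum hm h) k
  simp only [(h14per_iff _ _).1 hp]

open Finset in
theorem h14decomp {m n : ℕ} (hm : 1 ≤ m) (hn : 0 < n) (ζ : ℂ) :
    h14N m n ζ = ∑ e ∈ n.divisors, h14P m e (ζ ^ (n / e)) := by
  classical
  unfold h14N
  rw [← sum_fiberwise_of_maps_to (g := fun f => Function.minimalPeriod h14sh f) (t := n.divisors)]
  · refine sum_congr rfl fun e he => ?_
    obtain ⟨⟨k, rfl⟩, -⟩ := Nat.mem_divisors.1 he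
    have he0 : 0 < e := Nat.pos_of_mul_pos_right hn
    have hk0 : 0 < k := Nat.pos_of_mul_pos_left hn
    rw [Nat.mul_div_cancel_left _ he0]
    unfold h14P
    have hset : (h14UF m (e * k)).filter (fun f => Function.minimalPeriod h14sh f = e)
        = h14PF m e := by
      ext f
      rw [mem_filter, h14mem_UF hn, h14mem_PF he0]
      constructor
      · rintro ⟨⟨h1, h2⟩, h3⟩
        refine ⟨h3, ?_⟩
        have hp := Function.isPeriodicPt_minimalPeriod h14sh f
        rw [h3, h14per_iff] at hp
        rw [h14sum_mul hp] at h2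
        have : k * ∑ i ∈ range e, f i = k * ((m - 1) * e) := by
          rw [Nat.cast_id] at h2
          rw [h2]; ring
        exact Nat.eq_of_mul_eq_mul_left hk0 this
      · rintro ⟨h3, h2⟩
        have hp := Function.isPeriodicPt_minimalPeriod h14sh f
        rw [h3] at hp
        refine ⟨⟨hp.mul_const k, ?_⟩, h3⟩
        rw [h14per_iff] at hp
        rw [h14sum_mul hp, h2, Nat.cast_id]; ring
    rw [hset]
    refine sum_congr rfl fun f hf => ?_
    rw [h14mem_PF he0] at hf
    have hp := Function.isPeriodicPt_minimalPeriod h14sh f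
    rw [hf.1] at hp
    rw [h14W_mul hm hp hf.2, zpow_mul, zpow_natCast]
  · intro f hf
    rw [h14mem_UF hn] at hf
    exact Nat.mem_divisors.2 ⟨hf.1.minimalPeriod_dvd, hn.ne'⟩

open Finset in
theorem h14W_form {m n : ℕ} (hm : 1 ≤ m) (hn : 0 < n) {f : ℕ → ℕ}
    (h : ∑ i ∈ range n, f i = (m - 1) * n) :
    h14W m n f = (((m - 1) * ∑ i ∈ range n, i : ℕ) : ℤ) + ((∑ i ∈ range n, i * f i : ℕ) : ℤ)
      - ((n * ((n - 1) * (m - 1)) : ℕ) : ℤ) := by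
  have h2 := Finset.sum_range_id_mul_two n
  have h2' : (∑ i ∈ range n, (i : ℤ)) * 2 = n * (n - 1) := by
    have := congrArg (Nat.cast : ℕ → ℤ) h2
    push_cast [hn] at this
    exact this
  have h' : ∑ i ∈ range n, (f i : ℤ) = ((m : ℤ) - 1) * n := by
    rw [← Nat.cast_sum, h]
    push_cast [hm]
    ring
  have e1 : h14W m n f = ∑ i ∈ range n, (((n : ℤ) - 1) * (m - 1) - ((m : ℤ) - 1) * i
      - ((n : ℤ) - 1) * f i + i * f i) := by
    unfold h14W
    exact sum_congr rfl fun i _ => by ring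
  rw [e1]
  simp only [sum_add_distrib, sum_sub_distrib, ← mul_sum, h', sum_const, card_range]
  push_cast [hm, hn]
  simp only [nsmul_eq_mul]
  linear_combination (-(m : ℤ) + 1) * h2'

open Finset in
theorem h14N_eval {m d k : ℕ} (hm : 1 ≤ m) {ζ : ℂ} (hd : 0 < d) (hk : 0 < k)
    (hζ : IsPrimitiveRoot ζ d) :
    h14N m (d * k) ζ = ζ ^ ((m - 1) * ∑ i ∈ range (d * k), i) * ((h14UF m k).card : ℂ) := by
  have hn : 0 < d * k := Nat.mul_pos hd hk
  rw [← h14key hd hζ, mul_sum]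
  unfold h14N
  refine sum_congr rfl fun f hf => ?_
  have hz : ζ ≠ 0 := hζ.ne_zero hd.ne'
  rw [h14W_form hm hn ((h14mem_UF hn).1 hf).2, zpow_sub₀ hz, zpow_add₀ hz, zpow_natCast,
    zpow_natCast, zpow_natCast, mul_assoc d k, pow_mul ζ d, hζ.pow_eq_one, one_pow, div_one,
    ← prod_pow_eq_pow_sum]
  simp only [pow_mul]

theorem h14N_one (m k : ℕ) : h14N m k 1 = ((h14UF m k).card : ℂ) := by
  simp [h14N]

open Finset in
theorem h14eps {m d k : ℕ} (hm : 1 ≤ m) {ζ : ℂ} (hd : 0 < d) (hk : 0 < k)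
    (hζ : IsPrimitiveRoot ζ d) :
    ζ ^ ((m - 1) * ∑ i ∈ range (d * k), i) =
      if Even m ∧ Even (d * k) ∧ Odd k then -1 else 1 := by
  have hn : 0 < d * k := Nat.mul_pos hd hk
  have h2 := Finset.sum_range_id_mul_two (d * k)
  set t := ∑ i ∈ range (d * k), i with ht
  have hdvd1 : ∀ j, d ∣ j → ζ ^ j = 1 := fun j hj => (hζ.pow_eq_one_iff_dvd j).2 hj
  by_cases hme : Even m
  swap
  · rw [if_neg (fun h => hme h.1)]
    apply hdvd1
    obtain ⟨r, hr⟩ := Nat.not_even_iff_odd.1 hme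
    refine ⟨k * (d * k - 1) * r, ?_⟩
    rw [hr, Nat.add_sub_cancel]
    calc 2 * r * t = (t * 2) * r := by ring
      _ = _ := by rw [h2]; ring
  by_cases hne : Even (d * k)
  swap
  · rw [if_neg (fun h => hne h.2.1)]
    apply hdvd1
    obtain ⟨r, hr⟩ := Nat.not_even_iff_odd.1 hne
    have : t = d * k * r := by
      rw [hr, Nat.add_sub_cancel] at h2
      rw [hr]
      have : t * 2 = ((2 * r + 1) * r) * 2 := by rw [h2]; ring
      omega
    rw [this]
    exact ⟨(m - 1) * (k * r), by ring⟩
  obtain ⟨h, hh⟩ := hne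
  have ht' : t = h * (d * k - 1) := by
    have : t * 2 = (h * (d * k - 1)) * 2 := by
      have h3 : d * k * (d * k - 1) = (h + h) * (d * k - 1) := congrArg (· * (d * k - 1)) hh
      rw [h2, h3]
      ring
    omega
  have hodd : Odd ((m - 1) * (d * k - 1)) := by
    rw [Nat.odd_mul]
    constructor
    · obtain ⟨r, hr⟩ := hme
      exact ⟨r - 1, by omega⟩
    · exact ⟨h - 1, by omega⟩
  rw [show (m - 1) * t = h * ((m - 1) * (d * k - 1)) by rw [ht']; ring, pow_mul]
  have hsq : (ζ ^ h) ^ 2 = 1 := by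
    rw [← pow_mul]
    exact hdvd1 _ ⟨k, by omega⟩
  by_cases hko : Odd k
  · rw [if_pos ⟨hme, ⟨h, hh⟩, hko⟩]
    have : ζ ^ h = -1 := by
      rcases sq_eq_one_iff.1 hsq with h1 | h1
      · exfalso
        obtain ⟨j, hj⟩ := (hζ.pow_eq_one_iff_dvd h).1 h1
        have : d * k = d * (2 * j) := by rw [hh, hj]; ring
        have := Nat.eq_of_mul_eq_mul_left hd this
        rw [this] at hko
        exact (Nat.not_even_iff_odd.2 hko) ⟨j, by ring⟩
      · exact h1
    rw [this, hodd.neg_one_pow]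
  · rw [if_neg (fun h => hko h.2.2)]
    obtain ⟨r, hr⟩ := Nat.not_odd_iff_even.1 hko
    have : ζ ^ h = 1 := by
      apply hdvd1
      refine ⟨r, ?_⟩
      have : d * k = 2 * (d * r) := by rw [hr]; ring
      omega
    rw [this, one_pow]

theorem h14cond_fwd {d k e : ℕ} {ζ : ℂ} (hd : 0 < d) (hk : 0 < k) (hζ : IsPrimitiveRoot ζ d)
    (he : e ∣ d * k) (he4 : e % 4 = 2) (hz : ζ ^ (d * k / e) = -1) :
    Even (d * k) ∧ Odd k ∧ e / 2 ∣ k ∧ e = 2 * (e / 2) := by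
  have hn : 0 < d * k := Nat.mul_pos hd hk
  obtain ⟨j, hj⟩ := he
  have he0 : 0 < e := by omega
  rw [hj, Nat.mul_div_cancel_left _ he0] at hz
  have he2 : e = 2 * (e / 2) := by omega
  set f := e / 2 with hf
  have hfo : f % 2 = 1 := by omega
  have h1 : ζ ^ (2 * j) = 1 := by
    rw [mul_comm, pow_mul, hz]; norm_num
  obtain ⟨l, hl⟩ := (hζ.pow_eq_one_iff_dvd _).1 h1
  have hkl : k = f * l := by
    apply Nat.eq_of_mul_eq_mul_left hd
    calc d * k = f * (2 * j) := by rw [hj, he2]; ring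
      _ = _ := by rw [hl]; ring
  have hlo : Odd l := by
    by_contra hc
    obtain ⟨r, hr⟩ := Nat.not_odd_iff_even.1 hc
    have : j = d * r := by
      have : 2 * j = 2 * (d * r) := by rw [hl, hr]; ring
      omega
    rw [this, pow_mul, hζ.pow_eq_one, one_pow] at hz
    norm_num at hz
  refine ⟨⟨f * j, by rw [hj, he2]; ring⟩, ?_, ⟨l, hkl⟩, he2⟩
  rw [hkl, Nat.odd_mul]
  exact ⟨Nat.odd_iff.2 hfo, hlo⟩

theorem h14cond_bwd {d k f : ℕ} {ζ : ℂ} (hd : 0 < d) (hk : 0 < k) (hζ : IsPrimitiveRoot ζ d)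
    (hn : Even (d * k)) (hko : Odd k) (hf : f ∣ k) :
    2 * f ∣ d * k ∧ (2 * f) % 4 = 2 ∧ ζ ^ (d * k / (2 * f)) = -1 := by
  obtain ⟨l, rfl⟩ := hf
  have hd2 : Even d := by
    rcases Nat.even_mul.1 hn with h | h
    · exact h
    · exact absurd hko (Nat.not_odd_iff_even.2 h)
  obtain ⟨r, hr⟩ := hd2
  obtain ⟨hfo, hlo⟩ := Nat.odd_mul.1 hko
  have hf0 : 0 < 2 * f := by have := hfo.pos; omega
  have he : d * (f * l) = 2 * f * (r * l) := by rw [hr]; ring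
  refine ⟨⟨r * l, he⟩, ?_, ?_⟩
  · have := Nat.odd_iff.1 hfo
    omega
  · rw [he, Nat.mul_div_cancel_left _ hf0, pow_mul]
    have hsq : (ζ ^ r) ^ 2 = 1 := by
      rw [← pow_mul, show r * 2 = d by omega, hζ.pow_eq_one]
    have : ζ ^ r = -1 := by
      rcases sq_eq_one_iff.1 hsq with h | h
      · have := Nat.le_of_dvd (by omega) ((hζ.pow_eq_one_iff_dvd r).1 h)
        omega
      · exact h
    rw [this, hlo.neg_one_pow]

noncomputable def h14c (m n : ℕ) (ζ : ℂ) : ℂ :=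
  open Classical in
  (if ζ = 1 then h14P m n 1 else 0) -
    (if Even m ∧ n % 4 = 2 ∧ ζ = -1 then 2 * h14P m (n / 2) 1 else 0)

open Finset in
theorem h14sumc {m d k : ℕ} (hm : 1 ≤ m) {ζ : ℂ} (hd : 0 < d) (hk : 0 < k)
    (hζ : IsPrimitiveRoot ζ d) :
    ∑ e ∈ (d * k).divisors, h14c m e (ζ ^ (d * k / e)) = h14N m (d * k) ζ := by
  classical
  have hn : 0 < d * k := Nat.mul_pos hd hk
  have hN1 : ∑ e ∈ k.divisors, h14P m e 1 = ((h14UF m k).card : ℂ) := by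
    rw [← h14N_one, h14decomp hm hk]
    simp
  rw [h14N_eval hm hd hk hζ, h14eps hm hd hk hζ]
  unfold h14c
  rw [sum_sub_distrib]
  have hA : ∑ e ∈ (d * k).divisors, (if ζ ^ (d * k / e) = 1 then h14P m e 1 else 0)
      = ((h14UF m k).card : ℂ) := by
    rw [← hN1, ← sum_filter]
    refine sum_congr ?_ fun _ _ => rfl
    ext e
    rw [mem_filter, Nat.mem_divisors, Nat.mem_divisors]
    constructor
    · rintro ⟨⟨⟨j, hj⟩, -⟩, hz⟩
      have he0 : 0 < e := by
        rcases Nat.eq_zero_or_pos e with h | h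
        · rw [h, zero_mul] at hj; omega
        · exact h
      rw [hj, Nat.mul_div_cancel_left _ he0] at hz
      obtain ⟨l, hl⟩ := (hζ.pow_eq_one_iff_dvd _).1 hz
      refine ⟨⟨l, Nat.eq_of_mul_eq_mul_left hd ?_⟩, hk.ne'⟩
      rw [hj, hl]; ring
    · rintro ⟨⟨l, hl⟩, -⟩
      have he0 : 0 < e := by
        rcases Nat.eq_zero_or_pos e with h | h
        · rw [h, zero_mul] at hl; omega
        · exact h
      have he : d * k = e * (d * l) := by rw [hl]; ring
      refine ⟨⟨⟨_, he⟩, hn.ne'⟩, ?_⟩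
      rw [he, Nat.mul_div_cancel_left _ he0, pow_mul, hζ.pow_eq_one, one_pow]
  rw [hA]
  by_cases hc : Even m ∧ Even (d * k) ∧ Odd k
  · have hB : ∑ e ∈ (d * k).divisors, (if Even m ∧ e % 4 = 2 ∧ ζ ^ (d * k / e) = -1 then
        2 * h14P m (e / 2) 1 else 0) = 2 * ((h14UF m k).card : ℂ) := by
      rw [← hN1, ← sum_filter, mul_sum]
      symm
      refine sum_bij (fun f _ => 2 * f) ?_ ?_ ?_ ?_
      · intro f hf
        have := h14cond_bwd hd hk hζ hc.2.1 hc.2.2 (Nat.dvd_of_mem_divisors hf)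
        rw [mem_filter, Nat.mem_divisors]
        exact ⟨⟨this.1, hn.ne'⟩, hc.1, this.2⟩
      · intro a _ b _ h
        simpa using h
      · intro e he
        rw [mem_filter, Nat.mem_divisors] at he
        have := h14cond_fwd hd hk hζ he.1.1 he.2.2.1 he.2.2.2
        exact ⟨e / 2, Nat.mem_divisors.2 ⟨this.2.2.1, hk.ne'⟩, this.2.2.2.symm⟩
      · intro f _
        simp
    rw [hB, if_pos hc]
    ring
  · rw [if_neg hc, sum_eq_zero, sub_zero, one_mul]
    intro e he
    rw [if_neg]
    rintro ⟨h1, h2, h3⟩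
    have := h14cond_fwd hd hk hζ (Nat.dvd_of_mem_divisors he) h2 h3
    exact hc ⟨h1, this.1, this.2.1⟩

open Finset in
theorem h14claim {m : ℕ} (hm : 1 ≤ m) (n : ℕ) : ∀ (ζ : ℂ), 0 < n → ζ ^ n = 1 →
    h14P m n ζ = h14c m n ζ := by
  induction n using Nat.strong_induction_on with
  | _ n ih =>
  intro ζ hn hz
  have hζ := IsPrimitiveRoot.orderOf ζ
  obtain ⟨k, hk⟩ := hζ.dvd_of_pow_eq_one n hz
  have hd : 0 < orderOf ζ := Nat.pos_of_ne_zero fun h => by rw [h, zero_mul] at hk; omega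
  have hk0 : 0 < k := Nat.pos_of_ne_zero fun h => by rw [h, mul_zero] at hk; omega
  have h1 := h14sumc hm hd hk0 hζ
  rw [← hk, h14decomp hm hn, ← Nat.insert_self_properDivisors hn.ne',
    sum_insert Nat.self_notMem_properDivisors, sum_insert Nat.self_notMem_properDivisors] at h1
  have h2 : ∑ e ∈ n.properDivisors, h14c m e (ζ ^ (n / e))
      = ∑ e ∈ n.properDivisors, h14P m e (ζ ^ (n / e)) := by
    refine sum_congr rfl fun e he => ?_
    rw [Nat.mem_properDivisors] at he
    refine (ih e he.2 _ (Nat.pos_of_dvd_of_pos he.1 hn) ?_).symm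
    rw [← pow_mul, Nat.div_mul_cancel he.1, hz]
  rw [h2, Nat.div_self hn, pow_one] at h1
  exact (add_right_cancel h1).symm

theorem h14final {m n : ℕ} (hm : 1 ≤ m) (hn : 0 < n) {ζ : ℂ} (hz : ζ ^ n = 1) (h1 : ζ ≠ 1) :
    h14P m n ζ + (open Classical in if Even m ∧ n % 4 = 2 then 2 * h14P m (n / 2) (ζ ^ 2) else 0) = 0 := by
  classical
  rw [h14claim hm n ζ hn hz]
  unfold h14c
  rw [if_neg h1]
  by_cases hc : Even m ∧ n % 4 = 2
  · rw [if_pos hc]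
    have h2 : (ζ ^ 2) ^ (n / 2) = 1 := by
      rw [← pow_mul, show 2 * (n / 2) = n by omega, hz]
    rw [h14claim hm (n / 2) _ (by omega) h2]
    unfold h14c
    rw [if_neg (c := Even m ∧ n / 2 % 4 = 2 ∧ ζ ^ 2 = -1) (by rintro ⟨_, h, _⟩; omega)]
    by_cases h3 : ζ = -1
    · rw [if_pos ⟨hc.1, hc.2, h3⟩, if_pos (by rw [h3]; norm_num)]
      ring
    · rw [if_neg (fun h => h3 h.2.2), if_neg]
      · ring
      · intro h
        rcases sq_eq_one_iff.1 h with h | h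
        · exact h1 h
        · exact h3 h
  · rw [if_neg hc, if_neg (fun h => hc ⟨h.1, h.2.1⟩)]
    ring

def h14lst (n : ℕ) (f : ℕ → ℕ) : List ℕ := (List.range n).map f

theorem h14lst_length (n : ℕ) (f : ℕ → ℕ) : (h14lst n f).length = n := by simp [h14lst]

theorem h14lst_sum (n : ℕ) (f : ℕ → ℕ) : (h14lst n f).sum = ∑ i ∈ Finset.range n, f i := by
  rfl

theorem h14lst_wt (m n : ℕ) (f : ℕ → ℕ) : wtZ m (h14lst n f) = h14W m n f := by
  unfold wtZ h14W
  rw [h14lst_length]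
  refine Finset.sum_congr rfl fun i hi => ?_
  have : (h14lst n f).getD i 0 = f i := by
    simp [h14lst, List.getD, Finset.mem_range.1 hi]
  rw [this]

theorem h14lst_rotate {n : ℕ} {f : ℕ → ℕ} (hp : Function.IsPeriodicPt h14sh n f) (i : ℕ) :
    (h14lst n f).rotate i = h14lst n (h14sh^[i] f) := by
  apply List.ext_getElem
  · simp [h14lst]
  · intro j h1 h2
    rw [List.getElem_rotate]
    simp [h14lst, h14sh_iter, h14per_mod hp]

theorem h14lst_inj {n : ℕ} (hn : 0 < n) {f g : ℕ → ℕ} (hf : Function.IsPeriodicPt h14sh n f)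
    (hg : Function.IsPeriodicPt h14sh n g) (h : h14lst n f = h14lst n g) : f = g := by
  funext i
  rw [← h14per_mod hf, ← h14per_mod hg]
  have := List.map_inj_left.1 h (i % n) (List.mem_range.2 (Nat.mod_lt _ hn))
  exact this

theorem h14lst_surj {n : ℕ} (a : List ℕ) (ha : a.length = n) :
    ∃ f, Function.IsPeriodicPt h14sh n f ∧ a = h14lst n f := by
  refine ⟨fun i => a.getD (i % n) 0, (h14per_iff _ _).2 (fun i => by simp), ?_⟩
  apply List.ext_getElem
  · simp [h14lst, ha]
  · intro j h1 h2
    have : j < n := ha ▸ h1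
    simp [h14lst, Nat.mod_eq_of_lt this, h1]

theorem h14UPrim {m n : ℕ} (hn : 0 < n) : UPrim m n = h14lst n '' (h14PF m n : Set (ℕ → ℕ)) := by
  ext a
  constructor
  · rintro ⟨⟨h1, h2⟩, h3⟩
    obtain ⟨f, hf, rfl⟩ := h14lst_surj a h1
    refine ⟨f, ?_, rfl⟩
    rw [Finset.mem_coe, h14mem_PF hn]
    rw [h14lst_sum] at h2
    refine ⟨?_, h2⟩
    have hle := hf.minimalPeriod_le hn
    have hpos := hf.minimalPeriod_pos hn
    by_contra hc
    have hlt : Function.minimalPeriod h14sh f < n := lt_of_le_of_ne hle hc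
    refine h3 _ hpos (by rw [h14lst_length]; exact hlt) ?_
    rw [h14lst_rotate hf, Function.iterate_minimalPeriod]
  · rintro ⟨f, hf, rfl⟩
    rw [Finset.mem_coe, h14mem_PF hn] at hf
    have hp := Function.isPeriodicPt_minimalPeriod h14sh f
    rw [hf.1] at hp
    refine ⟨⟨h14lst_length _ _, by rw [h14lst_sum, hf.2]⟩, ?_⟩
    intro i hi hi' h
    rw [h14lst_length] at hi'
    rw [h14lst_rotate hp] at h
    have := h14lst_inj hn (hp.apply_iterate i) hp h
    have h2 : Function.IsPeriodicPt h14sh i f := this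
    have := h2.minimalPeriod_le hi
    omega

theorem h14lst_double {h : ℕ} {f : ℕ → ℕ} (hp : Function.IsPeriodicPt h14sh h f) :
    h14lst h f ++ h14lst h f = h14lst (h + h) f := by
  unfold h14lst
  rw [List.range_add, List.map_append, List.map_map]
  congr 1
  refine List.map_congr_left fun i _ => ?_
  simp only [Function.comp]
  rw [add_comm, (h14per_iff _ _).1 hp]

theorem h14UPrimPlus {m n : ℕ} (hn : 0 < n) :
    UPrimPlus m n = h14lst n '' (h14PF m n : Set (ℕ → ℕ)) ∪
      {a | (Even m ∧ n % 4 = 2) ∧ a ∈ h14lst n '' (h14PF m (n / 2) : Set (ℕ → ℕ))} := by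
  unfold UPrimPlus
  rw [h14UPrim hn]
  congr 1
  ext a
  have key : n % 4 = 2 → ∀ f ∈ (h14PF m (n / 2) : Set (ℕ → ℕ)),
      h14lst (n / 2) f ++ h14lst (n / 2) f = h14lst n f := by
    intro h f hf
    rw [Finset.mem_coe, h14mem_PF (by omega)] at hf
    have hp := Function.isPeriodicPt_minimalPeriod h14sh f
    rw [hf.1] at hp
    rw [h14lst_double hp, show n / 2 + n / 2 = n by omega]
  constructor
  · rintro ⟨h1, h2, b, hb, rfl⟩
    rw [h14UPrim (by omega)] at hb
    obtain ⟨f, hf, rfl⟩ := hb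
    exact ⟨⟨h1, h2⟩, f, hf, (key h2 f hf).symm⟩
  · rintro ⟨⟨h1, h2⟩, f, hf, rfl⟩
    refine ⟨h1, h2, h14lst (n / 2) f, ?_, (key h2 f hf).symm⟩
    rw [h14UPrim (by omega)]
    exact ⟨f, hf, rfl⟩

def h14orb (n : ℕ) (f : ℕ → ℕ) : Set (List ℕ) := rotClass (h14lst n f)

theorem h14mem_orb {n : ℕ} {f : ℕ → ℕ} (hp : Function.IsPeriodicPt h14sh n f) (b : List ℕ) :
    b ∈ h14orb n f ↔ ∃ i, b = h14lst n (h14sh^[i] f) := by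
  unfold h14orb rotClass
  simp only [Set.mem_ofPred_eq, h14lst_rotate hp]

theorem h14orb_iter {n : ℕ} (hn : 0 < n) {f : ℕ → ℕ} (hp : Function.IsPeriodicPt h14sh n f)
    (i : ℕ) : h14orb n (h14sh^[i] f) = h14orb n f := by
  ext b
  rw [h14mem_orb hp, h14mem_orb (hp.apply_iterate i)]
  constructor
  · rintro ⟨j, rfl⟩
    exact ⟨j + i, by rw [Function.iterate_add_apply]⟩
  · rintro ⟨j, rfl⟩
    refine ⟨j + (n * i - i), ?_⟩
    rw [← Function.iterate_add_apply]
    have h1 : i ≤ n * i := Nat.le_mul_of_pos_left i hn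
    rw [show j + (n * i - i) + i = j + n * i by omega, Function.iterate_add_apply,
      (hp.mul_const i : h14sh^[n * i] f = f)]

theorem h14orb_eq {n : ℕ} (hn : 0 < n) {f g : ℕ → ℕ} (hf : Function.IsPeriodicPt h14sh n f)
    (hg : Function.IsPeriodicPt h14sh n g) :
    h14orb n g = h14orb n f ↔ ∃ i, h14sh^[i] f = g := by
  constructor
  · intro h
    have : h14lst n g ∈ h14orb n g := (h14mem_orb hg _).2 ⟨0, rfl⟩
    rw [h, h14mem_orb hf] at this
    obtain ⟨i, hi⟩ := this
    exact ⟨i, (h14lst_inj hn hg (hf.apply_iterate i) hi).symm⟩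
  · rintro ⟨i, rfl⟩
    exact h14orb_iter hn hf i

open Finset in
theorem h14sum_sh {n : ℕ} {f : ℕ → ℕ} (hp : Function.IsPeriodicPt h14sh n f) (k : ℕ) :
    ∑ i ∈ range n, h14sh^[k] f i = ∑ i ∈ range n, f i := by
  induction k with
  | zero => rfl
  | succ k ih =>
    rw [← ih, Function.iterate_succ_apply']
    set g := h14sh^[k] f with hg
    have hgp : Function.IsPeriodicPt h14sh n g := hp.apply_iterate k
    have h1 := sum_range_succ g n
    rw [sum_range_succ'] at h1
    have h2 := (h14per_iff _ _).1 hgp 0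
    rw [zero_add] at h2
    rw [h2] at h1
    exact Nat.add_right_cancel h1

open Finset in
theorem h14W_sh {m n : ℕ} (hm : 1 ≤ m) {f : ℕ → ℕ} (hp : Function.IsPeriodicPt h14sh n f)
    (hs : ∑ i ∈ range n, f i = (m - 1) * n) :
    h14W m n (h14sh f) = h14W m n f - n * ((m : ℤ) - 1 - f 0) := by
  have h0 := h14bsum hm hs
  have h1 := sum_range_succ (fun i => ((n : ℤ) - i) * ((m : ℤ) - 1 - f i)) n
  rw [sum_range_succ', sub_self, zero_mul, add_zero] at h1
  have h2 : h14W m n f = ∑ i ∈ range n, ((n : ℤ) - i) * ((m : ℤ) - 1 - f i) := by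
    unfold h14W
    rw [← sub_zero (∑ i ∈ range n, ((n : ℤ) - i) * ((m : ℤ) - 1 - f i)), ← h0, ← sum_sub_distrib]
    exact sum_congr rfl fun i _ => by ring
  have h3 : h14W m n (h14sh f)
      = ∑ i ∈ range n, ((n : ℤ) - (i + 1 : ℕ)) * ((m : ℤ) - 1 - f (i + 1)) := by
    unfold h14W h14sh
    exact sum_congr rfl fun i _ => by push_cast; ring
  rw [h2, h3, ← h1]
  simp

open Finset in
theorem h14W_iter {m n : ℕ} (hm : 1 ≤ m) {f : ℕ → ℕ} (hp : Function.IsPeriodicPt h14sh n f)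
    (hs : ∑ i ∈ range n, f i = (m - 1) * n) (k : ℕ) :
    h14W m n (h14sh^[k] f) = h14W m n f - n * ∑ j ∈ range k, ((m : ℤ) - 1 - f j) := by
  induction k with
  | zero => simp
  | succ k ih =>
    rw [Function.iterate_succ_apply', h14W_sh hm (hp.apply_iterate k) (by rw [h14sum_sh hp, hs]),
      ih, sum_range_succ, h14sh_iter, zero_add]
    ring

open Finset in
theorem h14double_sum (b : ℕ → ℤ) (n : ℕ) :
    ∑ i ∈ range n, ∑ j ∈ range i, b j = ∑ j ∈ range n, ((n : ℤ) - 1 - j) * b j := by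
  induction n with
  | zero => simp
  | succ n ih =>
    rw [sum_range_succ, ih, sum_range_succ, ← sum_add_distrib]
    push_cast
    rw [show ((n : ℤ) + 1 - 1 - n) = 0 by ring, zero_mul, add_zero]
    exact sum_congr rfl fun i _ => by ring

open Finset in
theorem h14W_nonneg {m n : ℕ} (hm : 1 ≤ m) (hn : 0 < n) {f : ℕ → ℕ}
    (hp : Function.IsPeriodicPt h14sh n f) (hs : ∑ i ∈ range n, f i = (m - 1) * n) :
    ∃ i, 0 ≤ h14W m n (h14sh^[i] f) := by
  by_contra hc
  push Not at hc
  have h1 : ∑ i ∈ range n, h14W m n (h14sh^[i] f) < 0 :=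
    sum_neg (fun i _ => hc i) ⟨0, mem_range.2 hn⟩
  have h2 : ∑ i ∈ range n, h14W m n (h14sh^[i] f) = 0 := by
    simp only [h14W_iter hm hp hs]
    rw [sum_sub_distrib, ← mul_sum, h14double_sum]
    simp [h14W]
  omega

theorem h14wtOrb {m n : ℕ} (hm : 1 ≤ m) (hn : 0 < n) {f : ℕ → ℕ}
    (hp : Function.IsPeriodicPt h14sh n f) (hs : ∑ i ∈ Finset.range n, f i = (m - 1) * n) :
    0 ≤ wtOrb m (h14orb n f) ∧ ∃ i, wtOrb m (h14orb n f) = h14W m n (h14sh^[i] f) := by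
  have hset : wtZ m '' h14orb n f = Set.range (fun i => h14W m n (h14sh^[i] f)) := by
    ext w
    constructor
    · rintro ⟨b, hb, rfl⟩
      obtain ⟨i, rfl⟩ := (h14mem_orb hp b).1 hb
      exact ⟨i, (h14lst_wt _ _ _).symm⟩
    · rintro ⟨i, rfl⟩
      exact ⟨_, (h14mem_orb hp _).2 ⟨i, rfl⟩, h14lst_wt _ _ _⟩
  have hfin : (Set.range (fun i => h14W m n (h14sh^[i] f))).Finite := by
    refine ((Finset.range n).finite_toSet.image (fun i => h14W m n (h14sh^[i] f))).subset ?_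
    rintro _ ⟨i, rfl⟩
    refine ⟨i % n, by simpa using Nat.mod_lt _ hn, ?_⟩
    simp only [hp.iterate_mod_apply]
  unfold wtOrb
  rw [hset]
  constructor
  · obtain ⟨i, hi⟩ := h14W_nonneg hm hn hp hs
    exact hi.trans (le_csSup hfin.bddAbove ⟨i, rfl⟩)
  · obtain ⟨i, hi⟩ := Int.csSup_mem (Set.range_nonempty _) hfin.bddAbove
    exact ⟨i, hi.symm⟩

open Finset Classical in
theorem h14orbsum {m e k : ℕ} (hm : 1 ≤ m) (he : 0 < e) (hk : 0 < k) {ζ : ℂ}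
    (hz : ζ ^ (e * k) = 1) :
    (e : ℂ) * ∑ O ∈ (h14PF m e).image (h14orb (e * k)), ζ ^ wtOrb m O = h14P m e (ζ ^ k) := by
  have hn : 0 < e * k := Nat.mul_pos he hk
  have hz0 : ζ ≠ 0 := by
    rintro rfl
    rw [zero_pow hn.ne'] at hz
    exact zero_ne_one hz
  have facts : ∀ f ∈ h14PF m e, Function.IsPeriodicPt h14sh e f ∧
      Function.IsPeriodicPt h14sh (e * k) f ∧ ∑ i ∈ range (e * k), f i = (m - 1) * (e * k) ∧
      ∑ i ∈ range e, f i = (m - 1) * e := by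
    intro f hf
    rw [h14mem_PF he] at hf
    have hp := Function.isPeriodicPt_minimalPeriod h14sh f
    rw [hf.1] at hp
    refine ⟨hp, hp.mul_const k, ?_, hf.2⟩
    rw [h14sum_mul ((h14per_iff _ _).1 hp), hf.2, Nat.cast_id]; ring
  have hw : ∀ f ∈ h14PF m e, ζ ^ wtOrb m (h14orb (e * k) f) = ζ ^ h14W m (e * k) f := by
    intro f hf
    obtain ⟨_, h2, h3, _⟩ := facts f hf
    obtain ⟨-, i, hi⟩ := h14wtOrb hm hn h2 h3
    rw [hi, h14W_iter hm h2 h3, zpow_sub₀ hz0, zpow_mul ζ, zpow_natCast, hz, one_zpow, div_one]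
  rw [mul_sum, sum_image' (fun f => ζ ^ h14W m (e * k) f)]
  · unfold h14P
    refine sum_congr rfl fun f hf => ?_
    obtain ⟨h1, h2, h3, h4⟩ := facts f hf
    rw [h14W_mul hm h1 h4, zpow_mul, zpow_natCast]
  · intro f hf
    obtain ⟨h1, h2, h3, h4⟩ := facts f hf
    have hmin := ((h14mem_PF he).1 hf).1
    have hset : (h14PF m e).filter (fun g => h14orb (e * k) g = h14orb (e * k) f)
        = (range e).image (fun i => h14sh^[i] f) := by
      ext g
      rw [mem_filter, mem_image]
      constructor
      · rintro ⟨hg, h⟩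
        obtain ⟨i, hi⟩ := (h14orb_eq hn h2 (facts g hg).2.1).1 h
        exact ⟨i % e, mem_range.2 (Nat.mod_lt _ he), by rw [h1.iterate_mod_apply, hi]⟩
      · rintro ⟨i, -, rfl⟩
        refine ⟨?_, h14orb_iter hn h2 i⟩
        rw [h14mem_PF he, h14sum_sh h1]
        refine ⟨?_, h4⟩
        rw [Function.minimalPeriod_apply_iterate (Function.mk_mem_periodicPts he h1), hmin]
    have hcard : ((h14PF m e).filter (fun g => h14orb (e * k) g = h14orb (e * k) f)).card = e := by
      rw [hset, card_image_of_injOn, card_range]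
      intro i hi j hj h
      rw [coe_range] at hi hj
      have := Function.iterate_injOn_Iio_minimalPeriod (f := h14sh) (x := f)
      rw [hmin] at this
      exact this hi hj h
    have hsum : ∀ g ∈ (h14PF m e).filter (fun g => h14orb (e * k) g = h14orb (e * k) f),
        ζ ^ h14W m (e * k) g = ζ ^ wtOrb m (h14orb (e * k) f) := by
      intro g hg
      rw [mem_filter] at hg
      rw [← hw g hg.1, hg.2]
    rw [sum_congr rfl hsum, sum_const, hcard, nsmul_eq_mul]

open Classical in
noncomputable def h14orbs (m n : ℕ) : Finset (Set (List ℕ)) :=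
  (h14PF m n).image (h14orb n) ∪
    (if Even m ∧ n % 4 = 2 then (h14PF m (n / 2)).image (h14orb n) else ∅)

theorem h14orbs_eq {m n : ℕ} (hn : 0 < n) :
    orbitsOn (UPrimPlus m n) = (h14orbs m n : Set (Set (List ℕ))) := by
  rw [h14UPrimPlus hn]
  ext O
  unfold orbitsOn h14orbs
  rw [Finset.mem_coe, Finset.mem_union, Finset.mem_image]
  constructor
  · rintro ⟨a, (⟨f, hf, rfl⟩ | ⟨hc, f, hf, rfl⟩), rfl⟩
    · exact Or.inl ⟨f, hf, rfl⟩
    · right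
      rw [if_pos hc, Finset.mem_image]
      exact ⟨f, hf, rfl⟩
  · rintro (⟨f, hf, rfl⟩ | h)
    · exact ⟨_, Or.inl ⟨f, hf, rfl⟩, rfl⟩
    · by_cases hc : Even m ∧ n % 4 = 2
      · rw [if_pos hc, Finset.mem_image] at h
        obtain ⟨f, hf, rfl⟩ := h
        exact ⟨_, Or.inr ⟨hc, f, hf, rfl⟩, rfl⟩
      · rw [if_neg hc] at h
        simp at h

theorem h14orbs_vanish {m n : ℕ} (hm : 1 ≤ m) (hn : 0 < n) {ζ : ℂ} (hz : ζ ^ n = 1)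
    (h1 : ζ ≠ 1) : ∑ O ∈ h14orbs m n, ζ ^ wtOrb m O = 0 := by
  classical
  have hn0 : (n : ℂ) ≠ 0 := by exact_mod_cast hn.ne'
  have hA := h14orbsum (m := m) (e := n) (k := 1) hm hn one_pos (ζ := ζ) (by rwa [mul_one])
  rw [mul_one, pow_one] at hA
  have hF := h14final hm hn hz h1
  apply (mul_eq_zero.1 _).resolve_left hn0
  unfold h14orbs
  by_cases hc : Even m ∧ n % 4 = 2
  · have hn2 : n / 2 * 2 = n := by omega
    have hpos : 0 < n / 2 := by omega
    have hB := h14orbsum (m := m) (e := n / 2) (k := 2) hm hpos two_pos (ζ := ζ) (by rwa [hn2])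
    rw [hn2] at hB
    rw [if_pos hc] at hF ⊢
    rw [Finset.sum_union]
    · have hcast : (n : ℂ) = 2 * ((n / 2 : ℕ) : ℂ) := by
        have h5 : ((2 * (n / 2) : ℕ) : ℂ) = (n : ℂ) := by rw [mul_comm, hn2]
        rw [← h5, Nat.cast_mul, Nat.cast_ofNat]
      rw [← hA, ← hB] at hF
      rw [mul_add, ← hF, ← mul_assoc 2, ← hcast]
    · rw [Finset.disjoint_left]
      intro O h2 h3
      obtain ⟨f, hf, rfl⟩ := Finset.mem_image.1 h2
      obtain ⟨g, hg, hO⟩ := Finset.mem_image.1 h3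
      have hf' := ((h14mem_PF hn).1 hf).1
      have hg' := ((h14mem_PF hpos).1 hg).1
      have hfp := Function.isPeriodicPt_minimalPeriod h14sh f
      rw [hf'] at hfp
      have hgp := Function.isPeriodicPt_minimalPeriod h14sh g
      rw [hg'] at hgp
      have hgn : Function.IsPeriodicPt h14sh n g := by
        have := hgp.mul_const 2
        rwa [hn2] at this
      obtain ⟨i, hi⟩ := (h14orb_eq hn hfp hgn).1 hO
      have := Function.minimalPeriod_apply_iterate (Function.mk_mem_periodicPts hn hfp) i
      rw [hi, hf', hg'] at this
      omega
  · rw [if_neg hc] at hF ⊢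
    rw [Finset.union_empty, hA]
    simpa using hF

theorem h14orbs_nonneg {m n : ℕ} (hm : 1 ≤ m) (hn : 0 < n) :
    ∀ O ∈ h14orbs m n, 0 ≤ wtOrb m O := by
  classical
  intro O hO
  unfold h14orbs at hO
  rw [Finset.mem_union] at hO
  rcases hO with h | h
  · obtain ⟨f, hf, rfl⟩ := Finset.mem_image.1 h
    obtain ⟨h1, h2⟩ := (h14mem_PF hn).1 hf
    have hfp := Function.isPeriodicPt_minimalPeriod h14sh f
    rw [h1] at hfp
    exact (h14wtOrb hm hn hfp h2).1
  · by_cases hc : Even m ∧ n % 4 = 2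
    · rw [if_pos hc] at h
      obtain ⟨f, hf, rfl⟩ := Finset.mem_image.1 h
      obtain ⟨h1, h2⟩ := (h14mem_PF (by omega)).1 hf
      have hfp := Function.isPeriodicPt_minimalPeriod h14sh f
      rw [h1] at hfp
      have hn2 : n / 2 * 2 = n := by omega
      have hgn : Function.IsPeriodicPt h14sh n f := by
        have := hfp.mul_const 2
        rwa [hn2] at this
      refine (h14wtOrb hm hn hgn ?_).1
      have := h14sum_mul ((h14per_iff _ _).1 hfp) 2
      rw [hn2] at this
      rw [this, h2, Nat.cast_id, mul_comm 2, mul_assoc, hn2]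
    · rw [if_neg hc] at h
      simp at h

open Polynomial in
theorem h14dvd {n : ℕ} (hn : 0 < n) (p : ℤ[X])
    (h : ∀ ζ : ℂ, ζ ^ n = 1 → ζ ≠ 1 → (p.map (Int.castRingHom ℂ)).eval ζ = 0) :
    (∑ k ∈ Finset.range n, X ^ k : ℤ[X]) ∣ p := by
  have hmon : (∑ k ∈ Finset.range n, X ^ k : ℤ[X]).Monic := monic_geom_sum_X hn.ne'
  rw [← map_dvd_map (Int.castRingHom ℂ) Int.cast_injective hmon]
  set q := p.map (Int.castRingHom ℂ) with hq
  have hX : (X - 1 : ℂ[X]) ≠ 0 := X_sub_C_ne_zero 1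
  rw [← mul_dvd_mul_iff_right hX, Polynomial.map_sum]
  simp only [Polynomial.map_pow, Polynomial.map_X]
  rw [geom_sum_mul, X_pow_sub_one_eq_prod hn (Complex.isPrimitiveRoot_exp n hn.ne')]
  refine Finset.prod_dvd_of_coprime ?_ ?_
  · intro a _ b _ hab
    exact pairwise_coprime_X_sub_C Function.injective_id hab
  · intro ζ hζ
    rw [mem_nthRootsFinset hn] at hζ
    rw [dvd_iff_isRoot, IsRoot.def, eval_mul]
    by_cases h1 : ζ = 1
    · simp [h1]
    · rw [h ζ hζ h1, zero_mul]

/-- `Q_n(q)` is divisible by `[n] = 1 + q + … + q^{n−1}`, with polynomial quotient. -/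
theorem stmt14 (m n : ℕ) (hm : 1 ≤ m) (hn : 1 ≤ n) :
    ∃ R : Polynomial ℤ,
      Qplus m n
        = (∑ k ∈ Finset.range n, LaurentPolynomial.T (k : ℤ)) * Polynomial.toLaurent R := by
  have hn0 : 0 < n := hn
  set p : Polynomial ℤ := ∑ O ∈ h14orbs m n, Polynomial.X ^ (wtOrb m O).toNat with hp
  have hpL : Qplus m n = Polynomial.toLaurent p := by
    unfold Qplus
    rw [h14orbs_eq hn0, finsum_mem_coe_finset, hp, map_sum]
    refine Finset.sum_congr rfl fun O hO => ?_
    rw [Polynomial.toLaurent_X_pow, Int.toNat_of_nonneg (h14orbs_nonneg hm hn0 O hO)]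
  obtain ⟨R, hR⟩ := h14dvd hn0 p (by
    intro ζ hz h1
    rw [← h14orbs_vanish hm hn0 hz h1, hp, Polynomial.map_sum, Polynomial.eval_finsetSum]
    refine Finset.sum_congr rfl fun O hO => ?_
    rw [Polynomial.map_pow, Polynomial.map_X, Polynomial.eval_pow, Polynomial.eval_X,
      ← zpow_natCast, Int.toNat_of_nonneg (h14orbs_nonneg hm hn0 O hO)])
  refine ⟨R, ?_⟩
  rw [hpL, hR, map_mul, map_sum]
  simp only [Polynomial.toLaurent_X_pow]
end

section
/- Let m ≥ 1 and n ≥ 1. Then n times the number of C_n-orbits on U_n^{prim} equals ∑_{d | n} μ(n/d)·binom(md − 1, d − 1), where μ is the Möbius function. -/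
namespace Stmt16Aux

/-- The shift on infinite sequences. -/
def shift (f : ℕ → ℕ) : ℕ → ℕ := fun i => f (i + 1)

/-- The periodic extension of a list. -/
def ext (n : ℕ) (a : List ℕ) : ℕ → ℕ := fun i => a.getD (i % n) 0

lemma shift_iter (k : ℕ) (f : ℕ → ℕ) (i : ℕ) : (shift^[k] f) i = f (i + k) := by
  induction k generalizing f with
  | zero => rfl
  | succ k ih =>
    rw [Function.iterate_succ_apply, ih]
    simp [shift, add_assoc]

/-- Periodic sequences with prescribed sum over a period. -/
def PSet (m n : ℕ) : Set (ℕ → ℕ) :=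
  {f | Function.IsPeriodicPt shift n f ∧ ∑ i ∈ Finset.range n, f i = (m - 1) * n}

/-- Sequences of exact period `n` with prescribed sum over a period. -/
def QSet (m n : ℕ) : Set (ℕ → ℕ) :=
  {f | Function.minimalPeriod shift f = n ∧ ∑ i ∈ Finset.range n, f i = (m - 1) * n}

lemma periodic_iff (n : ℕ) (f : ℕ → ℕ) :
    Function.IsPeriodicPt shift n f ↔ ∀ i, f (i + n) = f i := by
  constructor
  · intro h i
    rw [← shift_iter n f i, h]
  · intro h
    funext i
    rw [shift_iter, h]

lemma ext_sum (n : ℕ) (a : List ℕ) (h : a.length = n) :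
    ∑ i ∈ Finset.range n, ext n a i = a.sum := by
  subst h
  have h := Fin.sum_univ_fun_getElem a id
  rw [List.map_id] at h
  rw [← h]
  rw [Finset.sum_range]
  refine Finset.sum_congr rfl fun i _ => ?_
  simp [ext, Nat.mod_eq_of_lt i.2]

lemma ext_periodic (n : ℕ) (a : List ℕ) : Function.IsPeriodicPt shift n (ext n a) := by
  rw [periodic_iff]
  intro i
  simp [ext]

lemma ext_inj (n : ℕ) (a b : List ℕ) (ha : a.length = n) (hb : b.length = n)
    (h : ext n a = ext n b) : a = b := by
  refine List.ext_getElem (by omega) fun i h1 h2 => ?_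
  have := congrFun h i
  have hi : i % n = i := Nat.mod_eq_of_lt (by omega)
  simpa [ext, hi, List.getD_eq_getElem, h1, h2] using this

lemma ext_rotate (n : ℕ) (hn : 0 < n) (a : List ℕ) (ha : a.length = n) (k : ℕ) :
    ext n (a.rotate k) = shift^[k] (ext n a) := by
  funext i
  rw [shift_iter]
  have h1 : i % n < n := Nat.mod_lt _ hn
  have h2 : (i + k) % n < n := Nat.mod_lt _ hn
  simp only [ext]
  rw [List.getD_eq_getElem _ _ (by simpa [ha] using h1),
    List.getD_eq_getElem _ _ (by simpa [ha] using h2), List.getElem_rotate]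
  congr 1
  rw [ha, Nat.mod_add_mod]

lemma ext_ofFn (n : ℕ) (hn : 0 < n) (f : ℕ → ℕ) (hf : Function.IsPeriodicPt shift n f) :
    ext n (List.ofFn fun i : Fin n => f i) = f := by
  rw [periodic_iff] at hf
  funext i
  have h1 : i % n < n := Nat.mod_lt _ hn
  simp only [ext]
  rw [List.getD_eq_getElem _ _ (by simpa using h1), List.getElem_ofFn]
  exact Function.Periodic.map_mod_nat hf i

lemma prim_iff (n : ℕ) (hn : 0 < n) (a : List ℕ) (ha : a.length = n) :
    Primitive a ↔ Function.minimalPeriod shift (ext n a) = n := by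
  have key : ∀ k, a.rotate k = a ↔ Function.IsPeriodicPt shift k (ext n a) := by
    intro k
    rw [Function.IsPeriodicPt, Function.IsFixedPt, ← ext_rotate n hn a ha]
    exact ⟨fun h => by rw [h], fun h => ext_inj n _ _ (by simpa using ha) ha h⟩
  have hp := ext_periodic n a
  constructor
  · intro h
    by_contra hne
    have hpos := hp.minimalPeriod_pos hn
    have hle := hp.minimalPeriod_le hn
    refine h _ hpos (by omega) ((key _).2 (Function.isPeriodicPt_minimalPeriod _ _))
  · intro h i hi hin hr
    have := ((key i).1 hr).minimalPeriod_le hi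
    omega

lemma image_U (m n : ℕ) (hn : 0 < n) : ext n '' USet m n = PSet m n := by
  ext f
  constructor
  · rintro ⟨a, ⟨h1, h2⟩, rfl⟩
    exact ⟨ext_periodic n a, by rw [ext_sum n a h1, h2]⟩
  · rintro ⟨h1, h2⟩
    refine ⟨_, ⟨by simp, ?_⟩, ext_ofFn n hn f h1⟩
    rw [← h2, List.sum_ofFn, Finset.sum_range]

lemma image_UPrim (m n : ℕ) (hn : 0 < n) : ext n '' UPrim m n = QSet m n := by
  ext f
  constructor
  · rintro ⟨a, ⟨⟨h1, h2⟩, h3⟩, rfl⟩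
    exact ⟨(prim_iff n hn a h1).1 h3, by rw [ext_sum n a h1, h2]⟩
  · rintro ⟨h1, h2⟩
    have hp : Function.IsPeriodicPt shift n f := by
      rw [← h1]; exact Function.isPeriodicPt_minimalPeriod _ _
    refine ⟨List.ofFn fun i : Fin n => f i, ⟨⟨by simp, ?_⟩, ?_⟩, ext_ofFn n hn f hp⟩
    · rw [← h2, List.sum_ofFn, Finset.sum_range]
    · rw [prim_iff n hn _ (by simp), ext_ofFn n hn f hp, h1]

lemma injOn_U (m n : ℕ) : Set.InjOn (ext n) (USet m n) :=
  fun a ha b hb h => ext_inj n a b ha.1 hb.1 h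

lemma image_ofFn (m n : ℕ) :
    USet m n = List.ofFn '' {P : Fin n → ℕ | ∑ i, P i = (m - 1) * n} := by
  ext a
  constructor
  · rintro ⟨rfl, h⟩
    refine ⟨a.get, ?_, List.ofFn_get a⟩
    show ∑ i, a.get i = _
    rw [← h, ← List.sum_ofFn, List.ofFn_get]
  · rintro ⟨P, h, rfl⟩
    exact ⟨by simp, by rw [List.sum_ofFn]; exact h⟩

lemma finite_U (m n : ℕ) : (USet m n).Finite := by
  rw [image_ofFn]
  apply Set.Finite.image
  have : Finite {P : Fin n → ℕ // ∑ i, P i = (m - 1) * n} :=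
    Finite.of_equiv _ (Sym.equivNatSumOfFintype (Fin n) ((m - 1) * n))
  have h2 : Finite ↑{P : Fin n → ℕ | ∑ i, P i = (m - 1) * n} := this
  exact Set.toFinite _

lemma ncard_U (m n : ℕ) (hm : 1 ≤ m) (hn : 0 < n) :
    (USet m n).ncard = (m * n - 1).choose (n - 1) := by
  rw [image_ofFn, Set.ncard_image_of_injective _ List.ofFn_injective]
  have h : Nat.card {P : Fin n → ℕ // ∑ i, P i = (m - 1) * n}
      = Nat.card (Sym (Fin n) ((m - 1) * n)) :=
    Nat.card_congr (Sym.equivNatSumOfFintype (Fin n) ((m - 1) * n)).symm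
  rw [Nat.card_eq_fintype_card (α := Sym _ _), Sym.card_sym_eq_choose, Fintype.card_fin] at h
  refine Eq.trans h ?_
  obtain ⟨k, rfl⟩ : ∃ k, m = k + 1 := ⟨m - 1, by omega⟩
  have e : (k + 1) * n = k * n + n := by ring
  simp only [Nat.add_sub_cancel, e]
  rw [show n + k * n - 1 = k * n + (n - 1) by omega,
    show k * n + n - 1 = k * n + (n - 1) by omega]
  exact Nat.choose_symm_add

lemma sum_period (d k : ℕ) (f : ℕ → ℕ) (hf : Function.IsPeriodicPt shift d f) :
    ∑ i ∈ Finset.range (d * k), f i = k * ∑ i ∈ Finset.range d, f i := by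
  rw [periodic_iff] at hf
  induction k with
  | zero => simp
  | succ k ih =>
    rw [Nat.mul_succ, Finset.sum_range_add, ih, add_mul, one_mul]
    congr 1
    refine Finset.sum_congr rfl fun i _ => ?_
    have := Function.Periodic.nat_mul (show Function.Periodic f d from hf) k i
    rw [add_comm, mul_comm]
    exact this

lemma P_eq (m n : ℕ) (hn : 0 < n) : PSet m n = ⋃ d ∈ n.divisors, QSet m d := by
  ext f
  simp only [Set.mem_iUnion, exists_prop, Nat.mem_divisors]
  have key : ∀ d, 0 < n → d ∣ n → Function.IsPeriodicPt shift d f →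
      (∑ i ∈ Finset.range n, f i = (m - 1) * n ↔ ∑ i ∈ Finset.range d, f i = (m - 1) * d) := by
    rintro d hn ⟨k, rfl⟩ hd
    rw [sum_period d k f hd]
    have hk : 0 < k := Nat.pos_of_mul_pos_left hn
    rw [show (m - 1) * (d * k) = k * ((m - 1) * d) by ring]
    exact Nat.mul_right_inj hk.ne'
  constructor
  · rintro ⟨h1, h2⟩
    exact ⟨_, ⟨h1.minimalPeriod_dvd, hn.ne'⟩, rfl,
      (key _ hn h1.minimalPeriod_dvd (Function.isPeriodicPt_minimalPeriod _ _)).1 h2⟩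
  · rintro ⟨d, ⟨hd, _⟩, rfl, h2⟩
    exact ⟨Function.isPeriodicPt_iff_minimalPeriod_dvd.2 hd,
      (key _ hn hd (Function.isPeriodicPt_minimalPeriod _ _)).2 h2⟩

lemma ncard_P (m n : ℕ) (hn : 0 < n) : (PSet m n).ncard = (USet m n).ncard := by
  rw [← image_U m n hn, Set.InjOn.ncard_image (injOn_U m n)]

lemma UPrim_sub (m n : ℕ) : UPrim m n ⊆ USet m n := fun _ h => h.1

lemma ncard_Q (m n : ℕ) (hn : 0 < n) : (QSet m n).ncard = (UPrim m n).ncard := by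
  rw [← image_UPrim m n hn, Set.InjOn.ncard_image ((injOn_U m n).mono (UPrim_sub m n))]

lemma sum_prim (m n : ℕ) (hn : 0 < n) :
    ∑ d ∈ n.divisors, (UPrim m d).ncard = (USet m n).ncard := by
  classical
  have hfin : ∀ d ∈ n.divisors, (QSet m d).Finite := by
    intro d hd
    rw [← image_UPrim m d (Nat.pos_of_mem_divisors hd)]
    exact ((finite_U m d).subset (UPrim_sub m d)).image _
  rw [← ncard_P m n hn, P_eq m n hn]
  have hfinP : (PSet m n).Finite := by
    rw [← image_U m n hn]; exact (finite_U m n).image _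
  rw [← P_eq m n hn, Set.ncard_eq_toFinset_card _ hfinP,
    Finset.card_eq_sum_card_fiberwise (f := Function.minimalPeriod shift) (t := n.divisors)]
  · refine Finset.sum_congr rfl fun d hd => ?_
    rw [← ncard_Q m d (Nat.pos_of_mem_divisors hd), ← Set.ncard_coe_finset]
    congr 1
    ext f
    simp only [Finset.coe_filter, Set.Finite.mem_toFinset, Set.mem_setOf_eq]
    rw [P_eq m n hn]
    simp only [Set.mem_iUnion, exists_prop]
    constructor
    · intro h
      exact ⟨⟨d, hd, h⟩, h.1⟩
    · rintro ⟨⟨e, he, h⟩, rfl⟩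
      have := h.1
      rw [this]; exact h
  · intro f hf
    have hf : f ∈ PSet m n := by simpa using hf
    simp only [Finset.mem_coe, Nat.mem_divisors]
    exact ⟨hf.1.minimalPeriod_dvd, hn.ne'⟩

lemma rotClass_eq_iff (a b : List ℕ) : rotClass b = rotClass a ↔ b ∈ rotClass a := by
  constructor
  · intro h
    rw [← h]
    exact ⟨0, by simp⟩
  · intro h
    have hab : a ~r b := by
      obtain ⟨i, rfl⟩ := h
      exact ⟨i, rfl⟩
    ext c
    constructor
    · rintro ⟨j, rfl⟩
      obtain ⟨k, hk⟩ := hab.trans ⟨j, rfl⟩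
      exact ⟨k, hk.symm⟩
    · rintro ⟨j, rfl⟩
      obtain ⟨k, hk⟩ := hab.symm.trans ⟨j, rfl⟩
      exact ⟨k, hk.symm⟩

lemma rotate_mem (m n : ℕ) (hn : 0 < n) (a : List ℕ) (ha : a ∈ UPrim m n) (k : ℕ) :
    a.rotate k ∈ UPrim m n := by
  obtain ⟨⟨h1, h2⟩, h3⟩ := ha
  refine ⟨⟨by simpa using h1, ?_⟩, ?_⟩
  · rw [← h2]; exact (List.rotate_perm a k).sum_eq
  · intro i hi hil h
    rw [List.length_rotate] at hil
    refine h3 i hi hil ?_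
    rw [List.rotate_rotate, add_comm, ← List.rotate_rotate] at h
    exact List.rotate_injective k h

lemma orbits (m n : ℕ) (hn : 0 < n) :
    n * (orbitsOn (UPrim m n)).ncard = (UPrim m n).ncard := by
  classical
  have hfin : (UPrim m n).Finite := (finite_U m n).subset (UPrim_sub m n)
  have ho : orbitsOn (UPrim m n) = rotClass '' UPrim m n := by
    ext O
    constructor
    · rintro ⟨a, ha, rfl⟩; exact ⟨a, ha, rfl⟩
    · rintro ⟨a, ha, rfl⟩; exact ⟨a, ha, rfl⟩
  have ho2 : (orbitsOn (UPrim m n)).ncard = (hfin.toFinset.image rotClass).card := by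
    rw [ho, ← Set.ncard_coe_finset]
    simp
  rw [ho2, Set.ncard_eq_toFinset_card _ hfin,
    Finset.card_eq_sum_card_image rotClass hfin.toFinset, Finset.sum_const_nat (m := n), mul_comm]
  intro O hO
  obtain ⟨a, ha, rfl⟩ := Finset.mem_image.1 hO
  have ha : a ∈ UPrim m n := by simpa using ha
  have hlen : a.length = n := ha.1.1
  have : hfin.toFinset.filter (fun b => rotClass b = rotClass a)
      = (Finset.range n).image (fun i => a.rotate i) := by
    ext b
    simp only [Finset.mem_filter, Set.Finite.mem_toFinset, rotClass_eq_iff, Finset.mem_image,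
      Finset.mem_range]
    constructor
    · rintro ⟨_, i, rfl⟩
      exact ⟨i % n, Nat.mod_lt _ hn, by rw [← hlen, List.rotate_mod]⟩
    · rintro ⟨i, _, rfl⟩
      exact ⟨rotate_mem m n hn a ha i, i, rfl⟩
  rw [this, Finset.card_image_of_injOn, Finset.card_range]
  have aux : ∀ i j, i < j → j < n → a.rotate i ≠ a.rotate j := by
    intro i j hij hj h
    refine ha.2 (j - i) (by omega) (by omega) (List.rotate_injective i ?_)
    show (a.rotate (j - i)).rotate i = a.rotate i
    rw [List.rotate_rotate, Nat.sub_add_cancel hij.le, h]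
  intro i hi j hj h
  simp only [Finset.coe_range, Set.mem_Iio] at hi hj
  rcases lt_trichotomy i j with hij | hij | hij
  · exact absurd h (aux i j hij hj)
  · exact hij
  · exact absurd h.symm (aux j i hij hi)

end Stmt16Aux

/-- `n` times the number of `C_n`-orbits on `U_n^{prim}` equals
`∑_{d ∣ n} μ(n/d)·binom(md − 1, d − 1)`. -/
theorem stmt16 (m n : ℕ) (hm : 1 ≤ m) (hn : 1 ≤ n) :
    (n : ℤ) * (Set.ncard (orbitsOn (UPrim m n)) : ℤ)
      = ∑ d ∈ n.divisors,
          ArithmeticFunction.moebius (n / d) * ((m * d - 1).choose (d - 1) : ℤ) := by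
  have h := (ArithmeticFunction.sum_eq_iff_sum_mul_moebius_eq
    (f := fun d => ((UPrim m d).ncard : ℤ))
    (g := fun d => ((m * d - 1).choose (d - 1) : ℤ))).1 (by
      intro k hk
      rw [← Stmt16Aux.ncard_U m k hm hk, ← Stmt16Aux.sum_prim m k hk]
      push_cast
      rfl) n hn
  have h2 := Stmt16Aux.orbits m n hn
  rw [← Nat.cast_mul, h2]
  simp only [Int.cast_id] at h
  rw [← h]
  exact Nat.sum_divisorsAntidiagonal'
    (f := fun x y => (ArithmeticFunction.moebius x) * ((m * y - 1).choose (y - 1) : ℤ))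
end

section
/- Let m ≥ 1, let f : ℕ → ℤ be any function, let n ≥ 1, and let s be a proper divisor of n (s | n, s ≠ n). If m is even, n is even, and s = n/2 is odd, then ∑_{d | n} μ(n/d)·(−1)^{(m−1)(d−1)s}·f(gcd(d,s)) = −2·∑_{d | s} μ(s/d)·f(d); in all other cases, ∑_{d | n} μ(n/d)·(−1)^{(m−1)(d−1)s}·f(gcd(d,s)) = 0. Here μ is the Möbius function. -/
lemma key_zero (f : ℕ → ℤ) (N s : ℕ) (hN : 0 < N) (hs : s ∣ N) (hsN : s ≠ N) :
    ∑ d ∈ N.divisors, ArithmeticFunction.moebius (N / d) * f (Nat.gcd d s) = 0 := by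
  have hs0 : 0 < s := Nat.pos_of_dvd_of_pos hs hN
  obtain ⟨F, hF⟩ : ∃ F : ℕ → ℤ, ∀ k > 0, ∑ i ∈ k.divisors, F i = f k :=
    ⟨fun k => ∑ x ∈ k.divisorsAntidiagonal, (ArithmeticFunction.moebius x.1 : ℤ) * f x.2,
      ArithmeticFunction.sum_eq_iff_sum_mul_moebius_eq.2 (fun k _ => by simp)⟩
  have h2 : ∀ k > 0, ∑ i ∈ k.divisors, (if i ∣ s then F i else 0) = f (Nat.gcd k s) := by
    intro k hk
    rw [← hF _ (Nat.gcd_pos_of_pos_left _ hk), ← Finset.sum_filter]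
    refine Finset.sum_congr ?_ fun _ _ => rfl
    ext i
    simp only [Finset.mem_filter, Nat.mem_divisors, Nat.dvd_gcd_iff]
    have : k.gcd s ≠ 0 := (Nat.gcd_pos_of_pos_left _ hk).ne'
    have := hk.ne'
    tauto
  have h3 := ArithmeticFunction.sum_eq_iff_sum_mul_moebius_eq.1 h2 N hN
  rw [if_neg (fun h => hsN (Nat.dvd_antisymm hs h))] at h3
  simp only [Int.cast_id] at h3
  rw [← h3, Nat.sum_divisorsAntidiagonal'
    (f := fun i j => ArithmeticFunction.moebius i * f (Nat.gcd j s))]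

lemma key_even (f : ℕ → ℤ) (k s : ℕ) (hk : 0 < k) (hodd : Odd s) :
    ∑ d ∈ (2 * k).divisors, ArithmeticFunction.moebius (2 * k / d) * (-1 : ℤ) ^ (d - 1)
        * f (Nat.gcd d s)
      = ∑ d ∈ (2 * k).divisors, ArithmeticFunction.moebius (2 * k / d) * f (Nat.gcd d s)
        - 2 * ∑ d ∈ k.divisors, ArithmeticFunction.moebius (k / d) * f (Nat.gcd d s) := by
  have h1 : ∑ d ∈ k.divisors, ArithmeticFunction.moebius (k / d) * f (Nat.gcd d s)
      = ∑ d ∈ (2 * k).divisors with 2 ∣ d,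
        ArithmeticFunction.moebius (2 * k / d) * f (Nat.gcd d s) := by
    refine Finset.sum_bij (fun d _ => 2 * d) ?_ ?_ ?_ ?_
    · intro d hd
      simp only [Nat.mem_divisors, Finset.mem_filter] at hd ⊢
      exact ⟨⟨Nat.mul_dvd_mul_left 2 hd.1, by omega⟩, dvd_mul_right _ _⟩
    · intro a _ b _ h
      simpa using h
    · intro b hb
      simp only [Nat.mem_divisors, Finset.mem_filter] at hb
      obtain ⟨⟨hb1, -⟩, c, rfl⟩ := hb
      exact ⟨c, by
        simp only [Nat.mem_divisors]
        exact ⟨Nat.dvd_of_mul_dvd_mul_left (by norm_num) hb1, hk.ne'⟩, rfl⟩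
    · intro d _
      rw [Nat.mul_div_mul_left _ _ (by norm_num : 0 < 2),
        Nat.Coprime.gcd_mul_left_cancel d (Nat.coprime_two_left.2 hodd)]
  rw [h1, Finset.sum_filter, Finset.mul_sum, ← Finset.sum_sub_distrib]
  refine Finset.sum_congr rfl fun d hd => ?_
  have hd0 := Nat.pos_of_mem_divisors hd
  by_cases h : 2 ∣ d
  · have : Odd (d - 1) := by rw [Nat.odd_iff]; omega
    rw [this.neg_one_pow, if_pos h]; ring
  · have : Even (d - 1) := by rw [Nat.even_iff]; omega
    rw [this.neg_one_pow, if_neg h]; ring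

/-- Möbius-inversion-type vanishing: for `f : ℕ → ℤ`, `n ≥ 1` and a proper divisor `s`
of `n`, the sum `∑_{d ∣ n} μ(n/d)·(−1)^{(m−1)(d−1)s}·f(gcd(d,s))` equals
`−2·∑_{d ∣ s} μ(s/d)·f(d)` when `m` is even, `n` is even and `s = n/2` is odd,
and equals `0` in all other cases. -/
theorem stmt19 (m : ℕ) (hm : 1 ≤ m) (f : ℕ → ℤ) (n s : ℕ) (hn : 1 ≤ n)
    (hs : s ∣ n) (hsn : s ≠ n) :
    ((Even m ∧ Even n ∧ s = n / 2 ∧ Odd s) →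
        (∑ d ∈ n.divisors,
            ArithmeticFunction.moebius (n / d) * (-1 : ℤ) ^ ((m - 1) * (d - 1) * s)
              * f (Nat.gcd d s))
          = -2 * ∑ d ∈ s.divisors, ArithmeticFunction.moebius (s / d) * f d)
    ∧ (¬(Even m ∧ Even n ∧ s = n / 2 ∧ Odd s) →
        (∑ d ∈ n.divisors,
            ArithmeticFunction.moebius (n / d) * (-1 : ℤ) ^ ((m - 1) * (d - 1) * s)
              * f (Nat.gcd d s))
          = 0) := by
  have hZ := key_zero f n s hn hs hsn
  by_cases hms : Even m ∧ Odd s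
  · obtain ⟨hme, hso⟩ := hms
    have hsign : ∀ d : ℕ, (-1 : ℤ) ^ ((m - 1) * (d - 1) * s) = (-1) ^ (d - 1) := by
      intro d
      have h1 : Odd ((m - 1) * s) := by
        refine Odd.mul ?_ hso
        rw [Nat.even_iff] at hme
        rw [Nat.odd_iff]; omega
      rw [show (m - 1) * (d - 1) * s = ((m - 1) * s) * (d - 1) by ring, pow_mul,
        h1.neg_one_pow]
    simp only [hsign]
    by_cases hne : Even n
    · obtain ⟨k, hk⟩ := hne.two_dvd
      subst hk
      have hk0 : 0 < k := by omega
      have hsk : s ∣ k := (Nat.coprime_two_right.2 hso).dvd_of_dvd_mul_left hs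
      rw [key_even f k s hk0 hso, hZ]
      refine ⟨?_, ?_⟩
      · rintro ⟨-, -, h, -⟩
        have : s = k := by omega
        subst this
        have : ∑ d ∈ s.divisors, ArithmeticFunction.moebius (s / d) * f (Nat.gcd d s)
            = ∑ d ∈ s.divisors, ArithmeticFunction.moebius (s / d) * f d := by
          refine Finset.sum_congr rfl fun d hd => ?_
          rw [Nat.gcd_eq_left (Nat.dvd_of_mem_divisors hd)]
        rw [this]; ring
      · intro h
        have : s ≠ k := fun e => h ⟨hme, hne, by omega, hso⟩
        rw [key_zero f k s hk0 hsk this]; ring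
    · refine ⟨fun h => absurd h.2.1 hne, fun _ => ?_⟩
      rw [← hZ]
      refine Finset.sum_congr rfl fun d hd => ?_
      have hdo : Odd d := (Nat.not_even_iff_odd.1 hne).of_dvd_nat (Nat.dvd_of_mem_divisors hd)
      have : Even (d - 1) := by
        rw [Nat.odd_iff] at hdo
        rw [Nat.even_iff]; omega
      rw [this.neg_one_pow, mul_one]
  · refine ⟨fun h => absurd ⟨h.1, h.2.2.2⟩ hms, fun _ => ?_⟩
    rw [← hZ]
    refine Finset.sum_congr rfl fun d _ => ?_
    have : Even ((m - 1) * (d - 1) * s) := by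
      by_cases hme : Even m
      · have : Even s := by
          rw [← Nat.not_odd_iff_even]; exact fun h => hms ⟨hme, h⟩
        exact this.mul_left _
      · have : Even (m - 1) := by
          rw [Nat.even_iff] at hme ⊢; omega
        exact (this.mul_right _).mul_right _
    rw [this.neg_one_pow, mul_one]
end
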